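/- arXiv:2212.00598 — 2 statements merged into one kernel-verified Lean document; each statement's English description precedes it below -/
import Mathlib

section
/- Let b ∈ ℝ[x₁,…,xₙ] be a polynomial, let f = (f₁,…,fₙ) be a vector of polynomials and g = (g_{ij}) an n×m matrix of polynomials in ℝ[x₁,…,xₙ], and let K = {x ∈ ℝⁿ : b(x) = 0 and (L_g b)_j(x) = 0 for all j = 1,…,m}. Then L_f b(x) ≥ 0 for all x ∈ K if and only if there exist a natural number a ≥ 0, SOS polynomials s₁, s₂, and polynomials p₁₀, p₂₀ ∈ ℝ[x₁,…,xₙ] and p₁ⱼ, p₂ⱼ ∈ ℝ[x₁,…,xₙ] (j = 1,…,m) such that, setting hᵢ = sᵢ + b·pᵢ₀ + Σ_{j=1}^m (L_g b)_j·pᵢⱼ for i = 1,2, the polynomial identity h₁·(L_f b) − h₂ − (L_f b)^{2a} = 0 holds in ℝ[x₁,…,xₙ]. -/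
/-- A polynomial is a sum of squares. -/
def IsSOS {n : ℕ} (s : MvPolynomial (Fin n) ℝ) : Prop :=
  ∃ (k : ℕ) (p : Fin k → MvPolynomial (Fin n) ℝ), s = ∑ i, (p i) ^ 2

/-- The Lie derivative `L_f b = ∑ i (∂b/∂xᵢ) fᵢ`. -/
noncomputable def LieF {n : ℕ} (f : Fin n → MvPolynomial (Fin n) ℝ) (b : MvPolynomial (Fin n) ℝ) :
    MvPolynomial (Fin n) ℝ :=
  ∑ i, MvPolynomial.pderiv i b * f i

/-- The `j`-th component of the Lie derivative `(L_g b)_j = ∑ i (∂b/∂xᵢ) g_{ij}`. -/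
noncomputable def LieG {n m : ℕ} (g : Fin n → Fin m → MvPolynomial (Fin n) ℝ) (b : MvPolynomial (Fin n) ℝ)
    (j : Fin m) : MvPolynomial (Fin n) ℝ :=
  ∑ i, MvPolynomial.pderiv i b * g i j

section Part1

open Polynomial

abbrev Cx (R : Type*) [Field R] := QuadraticAlgebra R (-1) 0

section FTA
variable {R : Type*} [Field R] [LinearOrder R] [IsStrictOrderedRing R]

instance cxFact : Fact (∀ r : R, r ^ 2 ≠ -1 + 0 * r) :=
  ⟨fun r h => by nlinarith [sq_nonneg r]⟩

theorem rc_sqrt [IsRealClosed R] {x : R} (hx : 0 ≤ x) : ∃ y, 0 ≤ y ∧ y ^ 2 = x := by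
  obtain ⟨r, hr⟩ := IsSquare.of_nonneg hx
  exact ⟨|r|, abs_nonneg r, by rw [sq_abs, hr, sq]⟩

theorem cx_sqrt [IsRealClosed R] (z : Cx R) : ∃ w : Cx R, w ^ 2 = z := by
  obtain ⟨a, b⟩ := z
  obtain ⟨n, hn0, hn⟩ := rc_sqrt (x := a ^ 2 + b ^ 2) (by positivity)
  have h1 : 0 ≤ n + a := by nlinarith [sq_nonneg b, abs_le_of_sq_le_sq' (a := a) (b := n) (by nlinarith [sq_nonneg b]) hn0]
  have h2 : 0 ≤ n - a := by nlinarith [sq_nonneg b, abs_le_of_sq_le_sq' (a := a) (b := n) (by nlinarith [sq_nonneg b]) hn0]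
  obtain ⟨x, hx0, hx⟩ := rc_sqrt (x := (n + a) / 2) (by positivity)
  obtain ⟨y, hy0, hy⟩ := rc_sqrt (x := (n - a) / 2) (by positivity)
  have key : (2 * x * y) ^ 2 = b ^ 2 := by
    have : (2 * x * y) ^ 2 = 4 * (x ^ 2) * (y ^ 2) := by ring
    rw [this, hx, hy]; linear_combination hn
  rcases sq_eq_sq_iff_eq_or_eq_neg.1 key with h | h
  · refine ⟨⟨x, y⟩, ?_⟩
    ext
    · simp [sq]; linear_combination hx - hy
    · simp [sq]; linear_combination h
  · refine ⟨⟨x, -y⟩, ?_⟩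
    ext
    · simp [sq]; linear_combination hx - hy
    · simp [sq]; linear_combination -h

theorem rc_odd [IsRealClosed R] (N : Type*) [Field N] [Algebra R N] [FiniteDimensional R N]
    (h : Odd (Module.finrank R N)) : Module.finrank R N = 1 := by
  obtain ⟨α, hα⟩ := Field.exists_primitive_element R N
  rw [Field.primitive_element_iff_minpoly_natDegree_eq] at hα
  rw [← hα] at h ⊢
  obtain ⟨x, hx⟩ := IsRealClosed.exists_isRoot_of_odd_natDegree h
  have hi := minpoly.irreducible (Algebra.IsIntegral.isIntegral (R := R) α)
  exact natDegree_eq_of_degree_eq_some (degree_eq_one_of_irreducible_of_root hi hx)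

theorem cx_quad [IsRealClosed R] (N : Type*) [Field N] [Algebra (Cx R) N]
    [FiniteDimensional (Cx R) N] : Module.finrank (Cx R) N ≠ 2 := by
  intro h
  obtain ⟨α, hα⟩ := Field.exists_primitive_element (Cx R) N
  rw [Field.primitive_element_iff_minpoly_natDegree_eq] at hα
  have hi := minpoly.irreducible (Algebra.IsIntegral.isIntegral (R := Cx R) α)
  set p := minpoly (Cx R) α
  have hm : p.Monic := minpoly.monic (Algebra.IsIntegral.isIntegral (R := Cx R) α)
  have hp2 : p.natDegree = 2 := by rw [hα, h]
  have hdeg : p.degree = 2 := by rw [degree_eq_natDegree hm.ne_zero, hp2]; rfl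
  obtain ⟨w, hw⟩ := cx_sqrt (p.coeff 1 ^ 2 - 4 * p.coeff 0)
  have hroot : p.IsRoot ((w - p.coeff 1) / 2) := by
    rw [IsRoot, eval_eq_sum_range, hp2]
    have hc : p.coeff 2 = 1 := by rw [← hp2]; exact hm
    simp only [Finset.sum_range_succ, Finset.sum_range_zero, hc]
    field_simp
    linear_combination hw
  have := degree_eq_one_of_irreducible_of_root hi hroot
  rw [hdeg] at this
  exact absurd this (by decide)

theorem cx_galois [IsRealClosed R] (N : Type*) [Field N] [Algebra R N] [Algebra (Cx R) N]
    [IsScalarTower R (Cx R) N] [FiniteDimensional R N] [IsGalois R N] :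
    Module.finrank (Cx R) N = 1 := by
  have : Fact (Nat.Prime 2) := ⟨Nat.prime_two⟩
  have : FiniteDimensional (Cx R) N := FiniteDimensional.right R (Cx R) N
  have : IsGalois (Cx R) N := IsGalois.tower_top_of_isGalois R (Cx R) N
  have h2 : Module.finrank R (Cx R) * Module.finrank (Cx R) N = Module.finrank R N :=
    Module.finrank_mul_finrank R (Cx R) N
  rw [QuadraticAlgebra.finrank_eq_two] at h2
  -- Sylow
  obtain ⟨H⟩ : Nonempty (Sylow 2 (N ≃ₐ[R] N)) := inferInstance
  have hcard : Nat.card (H : Subgroup (N ≃ₐ[R] N)) * (H : Subgroup (N ≃ₐ[R] N)).index = Nat.card (N ≃ₐ[R] N) :=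
    Subgroup.card_mul_index _
  have hN : Nat.card (N ≃ₐ[R] N) = Module.finrank R N := IsGalois.card_aut_eq_finrank R N
  have hfix := IntermediateField.finrank_fixedField_eq_card (H : Subgroup (N ≃ₐ[R] N))
  have htow := Module.finrank_mul_finrank R (IntermediateField.fixedField (H : Subgroup (N ≃ₐ[R] N))) N
  have hpos : 0 < Nat.card (H : Subgroup (N ≃ₐ[R] N)) := Nat.card_pos
  have hidx : Module.finrank R (IntermediateField.fixedField (H : Subgroup (N ≃ₐ[R] N))) = (H : Subgroup (N ≃ₐ[R] N)).index := by
    rw [hfix, ← hN, ← hcard, mul_comm] at htow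
    exact Nat.eq_of_mul_eq_mul_left hpos htow
  have hodd : Odd (H : Subgroup (N ≃ₐ[R] N)).index := by
    rw [← Nat.not_even_iff_odd, even_iff_two_dvd]
    exact H.not_dvd_index
  have h1 := rc_odd _ (hidx ▸ hodd)
  obtain ⟨k, hk⟩ := (IsPGroup.iff_card (p := 2)).1 H.isPGroup'
  have hN2 : Module.finrank R N = 2 ^ k := by
    rw [← hN, ← hcard, ← hidx, h1, mul_one, ← hk]
  rcases k with _ | _ | k
  · omega
  · omega
  · exfalso
    have hC : Module.finrank (Cx R) N = 2 ^ (k + 1) := by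
      rw [hN2] at h2; rw [pow_succ _ (k+1)] at h2; omega
    have hG : Nat.card (N ≃ₐ[Cx R] N) = 2 ^ (k + 1) := by
      rw [IsGalois.card_aut_eq_finrank, hC]
    obtain ⟨K, hK⟩ := Sylow.exists_subgroup_card_pow_prime (G := N ≃ₐ[Cx R] N) 2 (n := k)
      (by rw [hG]; exact pow_dvd_pow _ (by omega))
    have hfix' := IntermediateField.finrank_fixedField_eq_card K
    have htow' := Module.finrank_mul_finrank (Cx R) (IntermediateField.fixedField K) N
    rw [hfix', hC, hK, pow_succ, mul_comm] at htow'
    exact cx_quad _ (Nat.eq_of_mul_eq_mul_left (by positivity) htow')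

instance cx_isAlgClosed [IsRealClosed R] : IsAlgClosed (Cx R) := by
  refine IsAlgClosed.of_exists_root _ fun p hm hi => ?_
  have : Fact (Irreducible p) := ⟨hi⟩
  have : FiniteDimensional (Cx R) (AdjoinRoot p) := (AdjoinRoot.powerBasis hi.ne_zero).finite
  have : FiniteDimensional R (AdjoinRoot p) := FiniteDimensional.trans R (Cx R) (AdjoinRoot p)
  let N := IntermediateField.normalClosure R (AdjoinRoot p) (AlgebraicClosure (AdjoinRoot p))
  letI : Algebra (Cx R) N := ((algebraMap (AdjoinRoot p) N).comp (algebraMap (Cx R) (AdjoinRoot p))).toAlgebra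
  have : IsScalarTower (Cx R) (AdjoinRoot p) N := IsScalarTower.of_algebraMap_eq fun _ => rfl
  have : IsScalarTower R (Cx R) N := IsScalarTower.of_algebraMap_eq fun x => by
    rw [IsScalarTower.algebraMap_apply R (AdjoinRoot p) N, IsScalarTower.algebraMap_apply R (Cx R) (AdjoinRoot p)]; rfl
  have : Normal R (AlgebraicClosure (AdjoinRoot p)) := by
    have : Algebra.IsAlgebraic R (AlgebraicClosure (AdjoinRoot p)) :=
      Algebra.IsAlgebraic.trans R (AdjoinRoot p) _
    have : IsAlgClosure R (AlgebraicClosure (AdjoinRoot p)) := ⟨inferInstance, inferInstance⟩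
    exact IsAlgClosure.normal R _
  have : IsGalois R N := ⟨⟩
  have h1 := cx_galois (R := R) N
  have h2 := Module.finrank_mul_finrank (Cx R) (AdjoinRoot p) N
  rw [h1] at h2
  have h3 := Nat.eq_one_of_mul_eq_one_right h2
  have h4 : p.natDegree = 1 := by
    rw [(AdjoinRoot.powerBasis hi.ne_zero).finrank, AdjoinRoot.powerBasis_dim] at h3; exact h3
  exact exists_root_of_degree_eq_one (by rw [degree_eq_natDegree hi.ne_zero, h4]; rfl)
end FTA

end Part1

section Part2

open Polynomial
open scoped QuadraticAlgebra

section Key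
variable {k E : Type*} [Field k] [Field E] [Algebra k E] [FiniteDimensional k E] [CharZero k]
variable {R : Type*} [Field R] [LinearOrder R] [IsStrictOrderedRing R] [Algebra k R]

noncomputable def cxConj (k R : Type*) [Field k] [Field R] [Algebra k R] : Cx R →ₐ[k] Cx R where
  toFun z := ⟨z.re, -z.im⟩
  map_one' := by ext <;> simp
  map_zero' := by ext <;> simp
  map_add' x y := by ext <;> simp; ring
  map_mul' x y := by ext <;> simp; ring
  commutes' r := by
    have : algebraMap k (Cx R) r = ⟨algebraMap k R r, 0⟩ := rfl
    rw [this]; ext <;> simp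

theorem cxConj_cxConj (z : Cx R) : cxConj k R (cxConj k R z) = z := by
  ext <;> simp [cxConj]

noncomputable def realPt (τ : E →ₐ[k] Cx R) (h : (cxConj k R).comp τ = τ) : E →ₐ[k] R where
  toFun x := (τ x).re
  map_one' := by simp
  map_zero' := by simp
  map_add' x y := by simp
  map_mul' x y := by
    have h1 : (τ x).im = 0 := by
      have := congrArg QuadraticAlgebra.im (DFunLike.congr_fun h x)
      simp [cxConj] at this
      linarith
    simp [h1]
  commutes' r := by
    have : τ (algebraMap k E r) = ⟨algebraMap k R r, 0⟩ := τ.commutes r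
    rw [this]

noncomputable def ofRealPt (ρ : E →ₐ[k] R) : E →ₐ[k] Cx R where
  toFun x := ⟨ρ x, 0⟩
  map_one' := by ext <;> simp
  map_zero' := by ext <;> simp
  map_add' x y := by ext <;> simp
  map_mul' x y := by ext <;> simp
  commutes' r := by
    rw [ρ.commutes]; rfl

theorem card_half {T : Type*} [Fintype T] [DecidableEq T] (c : T → T) (hc : ∀ t, c (c t) = t) :
    ∃ S : Finset T, 2 * S.card + (Finset.univ.filter (fun t => c t = t)).card ≤ Fintype.card T ∧
      ∀ t, t ∈ S ∨ c t ∈ S ∨ c t = t := by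
  classical
  let e := Fintype.equivFin T
  let A := Finset.univ.filter (fun t => e t < e (c t))
  let B := Finset.univ.filter (fun t => e (c t) < e t)
  have hB : B = A.image c := by
    ext t
    simp only [A, B, Finset.mem_filter, Finset.mem_univ, true_and, Finset.mem_image]
    constructor
    · intro h; exact ⟨c t, by rwa [hc], hc t⟩
    · rintro ⟨s, hs, rfl⟩; rwa [hc]
  have hBc : B.card = A.card := by
    rw [hB, Finset.card_image_of_injective]
    intro a b hab
    rw [← hc a, hab, hc]
  refine ⟨A, ?_, ?_⟩
  · have h1 : Disjoint A B := by
      rw [Finset.disjoint_left]; intro t ht ht'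
      simp only [A, B, Finset.mem_filter, Finset.mem_univ, true_and] at ht ht'
      exact lt_asymm ht ht'
    have h2 : Disjoint (A ∪ B) (Finset.univ.filter (fun t => c t = t)) := by
      rw [Finset.disjoint_left]; intro t ht ht'
      simp only [A, B, Finset.mem_union, Finset.mem_filter, Finset.mem_univ, true_and] at ht ht'
      rw [ht'] at ht; simp at ht
    rw [two_mul]
    nth_rewrite 2 [← hBc]
    rw [← Finset.card_union_of_disjoint h1, ← Finset.card_union_of_disjoint h2]
    exact Finset.card_le_univ _
  · intro t
    rcases lt_trichotomy (e t) (e (c t)) with h | h | h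
    · left; simpa [A] using h
    · right; right; exact (e.injective h).symm
    · right; left; simpa [A, hc] using h

theorem exists_ker {ι T : Type*} [Fintype ι] (S : Finset ι) (T' : Finset T)
    (L : T → (ι → R) →ₗ[R] R) (h : T'.card < S.card) :
    ∃ c : ι → R, c ≠ 0 ∧ (∀ i, i ∉ S → c i = 0) ∧ ∀ t ∈ T', L t c = 0 := by
  classical
  let ext : (S → R) →ₗ[R] (ι → R) :=
    { toFun := fun c i => if hi : i ∈ S then c ⟨i, hi⟩ else 0
      map_add' := fun a b => by ext i; by_cases hi : i ∈ S <;> simp [hi]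
      map_smul' := fun a b => by ext i; by_cases hi : i ∈ S <;> simp [hi] }
  let M : (S → R) →ₗ[R] (T' → R) := LinearMap.pi fun t => (L t.1).comp ext
  have : LinearMap.ker M ≠ ⊥ := LinearMap.ker_ne_bot_of_finrank_lt (by simpa using h)
  obtain ⟨c, hc, hc0⟩ := Submodule.exists_mem_ne_zero_of_ne_bot this
  refine ⟨ext c, ?_, ?_, ?_⟩
  · intro h0
    apply hc0
    ext i
    have := congrFun h0 i.1
    simpa [ext] using this
  · intro i hi; simp [ext, hi]
  · intro t ht
    exact congrFun hc ⟨t, ht⟩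

theorem trace_identity [IsRealClosed R] {ι : Type*} [Fintype ι] [DecidableEq ι] (v : ι → E)
    (hv : ∀ i j, i ≠ j → Algebra.trace k E (v i * v j) = 0) (c : ι → R) :
    ∑ τ : E →ₐ[k] Cx R, (∑ i, c i • τ (v i)) ^ 2 =
      algebraMap R (Cx R) (∑ i, c i ^ 2 * algebraMap k R (Algebra.trace k E (v i * v i))) := by
  have h1 : ∀ τ : E →ₐ[k] Cx R, (∑ i, c i • τ (v i)) ^ 2 =
      ∑ i, ∑ j, (c i * c j) • τ (v i * v j) := by
    intro τ
    rw [sq, Finset.sum_mul_sum]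
    refine Finset.sum_congr rfl fun i _ => Finset.sum_congr rfl fun j _ => ?_
    rw [map_mul, smul_mul_smul_comm]
  simp_rw [h1]
  rw [Finset.sum_comm, map_sum]
  refine Finset.sum_congr rfl fun i _ => ?_
  rw [Finset.sum_comm, Finset.sum_eq_single i]
  · rw [← Finset.smul_sum, ← trace_eq_sum_embeddings, Algebra.smul_def, sq]
    simp only [map_mul]
    rfl
  · intro j _ hj
    rw [← Finset.smul_sum, ← trace_eq_sum_embeddings, hv i j hj.symm, map_zero, smul_zero]
  · simp

theorem neg_count [IsRealClosed R] {ι : Type*} [Fintype ι] [DecidableEq ι] (v : Module.Basis ι k E)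
    (hv : ∀ i j, i ≠ j → Algebra.trace k E (v i * v j) = 0) (ρ : E →ₐ[k] R) :
    2 * (Finset.univ.filter fun i =>
      algebraMap k R (Algebra.trace k E (v i * v i)) < 0).card < Fintype.card ι := by
  classical
  have hcard : Fintype.card (E →ₐ[k] Cx R) = Fintype.card ι := by
    rw [AlgHom.card, Module.finrank_eq_card_basis v]
  obtain ⟨T, hT, hT'⟩ := card_half (T := E →ₐ[k] Cx R) (fun τ => (cxConj k R).comp τ)
    (fun τ => by ext x : 1; exact cxConj_cxConj (k := k) (R := R) _)
  have hfix : 0 < (Finset.univ.filter (fun τ : E →ₐ[k] Cx R => (cxConj k R).comp τ = τ)).card := by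
    refine Finset.card_pos.2 ⟨ofRealPt ρ, ?_⟩
    simp only [Finset.mem_filter, Finset.mem_univ, true_and]
    ext x <;> simp [cxConj, ofRealPt]
  by_contra hlt
  push Not at hlt
  set S := Finset.univ.filter fun i => algebraMap k R (Algebra.trace k E (v i * v i)) < 0
  obtain ⟨c, hc0, hcS, hcT⟩ := exists_ker S T (fun τ =>
    { toFun := fun c => (∑ i, c i • τ (v i)).im
      map_add' := fun a b => by simp [add_smul, Finset.sum_add_distrib]
      map_smul' := fun a b => by simp [mul_smul, ← Finset.smul_sum] }) (by omega)
  simp only [LinearMap.coe_mk, AddHom.coe_mk] at hcT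
  have him : ∀ τ : E →ₐ[k] Cx R, (∑ i, c i • τ (v i)).im = 0 := by
    have hcj : ∀ τ : E →ₐ[k] Cx R, (∑ i, c i • ((cxConj k R).comp τ) (v i)).im = - (∑ i, c i • τ (v i)).im := by
      intro τ
      have : ∀ s : Finset ι, (∑ i ∈ s, c i • ((cxConj k R).comp τ) (v i)).im = - (∑ i ∈ s, c i • τ (v i)).im := by
        intro s
        induction s using Finset.induction_on with
        | empty => simp
        | insert a s ha ih => rw [Finset.sum_insert ha, Finset.sum_insert ha]; simp only [QuadraticAlgebra.im_add, ih]; simp [cxConj]; ring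
      exact this _
    intro τ
    rcases hT' τ with h | h | h
    · exact hcT τ h
    · have := hcT _ h; rw [hcj] at this; linarith
    · have := hcj τ; rw [h] at this; linarith
  have key := congrArg QuadraticAlgebra.re (trace_identity (R := R) v hv c)
  have hre : ∀ s : Finset (E →ₐ[k] Cx R), (∑ τ ∈ s, (∑ i, c i • τ (v i)) ^ 2).re =
      ∑ τ ∈ s, (∑ i, c i • τ (v i)).re ^ 2 := by
    intro s
    induction s using Finset.induction_on with
    | empty => simp
    | insert a s ha ih => rw [Finset.sum_insert ha, Finset.sum_insert ha, ← ih, QuadraticAlgebra.re_add, sq, QuadraticAlgebra.re_mul, him]; simp [sq]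
  rw [hre, QuadraticAlgebra.algebraMap_re] at key
  have hneg : ∀ i, c i ^ 2 * algebraMap k R (Algebra.trace k E (v i * v i)) ≤ 0 := by
    intro i
    by_cases hi : i ∈ S
    · have := (Finset.mem_filter.1 hi).2
      exact mul_nonpos_of_nonneg_of_nonpos (sq_nonneg _) this.le
    · simp [hcS i hi]
  have hz : ∑ i, c i ^ 2 * algebraMap k R (Algebra.trace k E (v i * v i)) = 0 :=
    le_antisymm (Finset.sum_nonpos fun i _ => hneg i) (key ▸ Finset.sum_nonneg fun i _ => sq_nonneg _)
  rw [Finset.sum_eq_zero_iff_of_nonpos (fun i _ => hneg i)] at hz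
  apply hc0
  ext i
  by_cases hi : i ∈ S
  · have h1 := (Finset.mem_filter.1 hi).2
    have h2 := hz i (Finset.mem_univ _)
    simpa [h1.ne] using h2
  · exact hcS i hi

theorem pos_count [IsRealClosed R] {ι : Type*} [Fintype ι] [DecidableEq ι] (v : Module.Basis ι k E)
    (hv : ∀ i j, i ≠ j → Algebra.trace k E (v i * v j) = 0) (hρ : IsEmpty (E →ₐ[k] R)) :
    2 * (Finset.univ.filter fun i =>
      0 < algebraMap k R (Algebra.trace k E (v i * v i))).card ≤ Fintype.card ι := by
  classical
  have hcard : Fintype.card (E →ₐ[k] Cx R) = Fintype.card ι := by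
    rw [AlgHom.card, Module.finrank_eq_card_basis v]
  obtain ⟨T, hT, hT'⟩ := card_half (T := E →ₐ[k] Cx R) (fun τ => (cxConj k R).comp τ)
    (fun τ => by ext x : 1; exact cxConj_cxConj (k := k) (R := R) _)
  by_contra hlt
  push Not at hlt
  set S := Finset.univ.filter fun i => 0 < algebraMap k R (Algebra.trace k E (v i * v i))
  obtain ⟨c, hc0, hcS, hcT⟩ := exists_ker S T (fun τ =>
    { toFun := fun c => (∑ i, c i • τ (v i)).re
      map_add' := fun a b => by simp [add_smul, Finset.sum_add_distrib]
      map_smul' := fun a b => by simp [mul_smul, ← Finset.smul_sum] }) (by omega)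
  simp only [LinearMap.coe_mk, AddHom.coe_mk] at hcT
  have him : ∀ τ : E →ₐ[k] Cx R, (∑ i, c i • τ (v i)).re = 0 := by
    have hcj : ∀ τ : E →ₐ[k] Cx R, (∑ i, c i • ((cxConj k R).comp τ) (v i)).re = (∑ i, c i • τ (v i)).re := by
      intro τ
      have : ∀ s : Finset ι, (∑ i ∈ s, c i • ((cxConj k R).comp τ) (v i)).re = (∑ i ∈ s, c i • τ (v i)).re := by
        intro s
        induction s using Finset.induction_on with
        | empty => simp
        | insert a s ha ih => rw [Finset.sum_insert ha, Finset.sum_insert ha]; simp only [QuadraticAlgebra.re_add, ih]; simp [cxConj]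
      exact this _
    intro τ
    rcases hT' τ with h | h | h
    · exact hcT τ h
    · have := hcT _ h; rwa [hcj] at this
    · exact hρ.elim (realPt τ h)
  have key := congrArg QuadraticAlgebra.re (trace_identity (R := R) v hv c)
  have hre : ∀ s : Finset (E →ₐ[k] Cx R), (∑ τ ∈ s, (∑ i, c i • τ (v i)) ^ 2).re =
      ∑ τ ∈ s, - (∑ i, c i • τ (v i)).im ^ 2 := by
    intro s
    induction s using Finset.induction_on with
    | empty => simp
    | insert a s ha ih => rw [Finset.sum_insert ha, Finset.sum_insert ha, ← ih, QuadraticAlgebra.re_add, sq, QuadraticAlgebra.re_mul, him]; simp [sq]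
  rw [hre, QuadraticAlgebra.algebraMap_re] at key
  have hneg : ∀ i, 0 ≤ c i ^ 2 * algebraMap k R (Algebra.trace k E (v i * v i)) := by
    intro i
    by_cases hi : i ∈ S
    · have := (Finset.mem_filter.1 hi).2
      exact mul_nonneg (sq_nonneg _) this.le
    · simp [hcS i hi]
  have hz : ∑ i, c i ^ 2 * algebraMap k R (Algebra.trace k E (v i * v i)) = 0 :=
    le_antisymm (key ▸ Finset.sum_nonpos fun i _ => neg_nonpos.2 (sq_nonneg _)) (Finset.sum_nonneg fun i _ => hneg i)
  rw [Finset.sum_eq_zero_iff_of_nonneg (fun i _ => hneg i)] at hz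
  apply hc0
  ext i
  by_cases hi : i ∈ S
  · have h1 := (Finset.mem_filter.1 hi).2
    have h2 := hz i (Finset.mem_univ _)
    simpa [h1.ne'] using h2
  · exact hcS i hi

theorem transfer [IsRealClosed R] {R' : Type*} [Field R'] [LinearOrder R'] [IsStrictOrderedRing R'] [Algebra k R']
    [IsRealClosed R'] (hs : ∀ x : k, 0 < algebraMap k R x → 0 < algebraMap k R' x)
    (ρ : E →ₐ[k] R) : Nonempty (E →ₐ[k] R') := by
  classical
  by_contra hne
  rw [not_nonempty_iff] at hne
  haveI : Invertible (2 : k) := invertibleOfNonzero two_ne_zero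
  obtain ⟨v, hv⟩ := LinearMap.BilinForm.exists_orthogonal_basis (B := Algebra.traceForm k E)
    ⟨(Algebra.traceForm_isSymm k).eq⟩
  have hv' : ∀ i j, i ≠ j → Algebra.trace k E (v i * v j) = 0 := fun i j hij => hv hij
  have h0 : ∀ i, Algebra.trace k E (v i * v i) ≠ 0 := by
    intro i hi
    have hnd := traceForm_nondegenerate k E
    have : v i = 0 := by
      apply hnd.1
      intro y
      rw [← v.sum_repr y, map_sum]
      refine Finset.sum_eq_zero fun j _ => ?_
      rw [map_smul, Algebra.traceForm_apply]
      by_cases hij : i = j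
      · rw [← hij, hi, smul_zero]
      · rw [hv' i j hij, smul_zero]
    exact v.ne_zero i this
  have h1 := neg_count v hv' ρ
  have h2 := pos_count v hv' hne
  have h3 : Fintype.card (Fin (Module.finrank k E)) ≤ (Finset.univ.filter fun i =>
      algebraMap k R (Algebra.trace k E (v i * v i)) < 0).card + (Finset.univ.filter fun i =>
      0 < algebraMap k R' (Algebra.trace k E (v i * v i))).card := by
    rw [← Finset.card_univ]
    refine le_trans (Finset.card_le_card ?_) (Finset.card_union_le _ _)
    intro i _
    simp only [Finset.mem_union, Finset.mem_filter, Finset.mem_univ, true_and]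
    rcases lt_trichotomy (algebraMap k R (Algebra.trace k E (v i * v i))) 0 with h | h | h
    · exact Or.inl h
    · exact absurd ((map_eq_zero _).1 h) (h0 i)
    · exact Or.inr (hs _ h)
  omega
end Key

end Part2

section Part3

open Polynomial
open scoped QuadraticAlgebra

section SignL
variable {F : Type*} [Field F] [LinearOrder F] [IsStrictOrderedRing F] [IsRealClosed F]
variable {R : Type*} [Field R] [LinearOrder R] [IsStrictOrderedRing R] [Algebra F R]

theorem rc_map_pos {c : F} (hc : 0 < c) : 0 < algebraMap F R c := by
  obtain ⟨y, _, rfl⟩ := rc_sqrt hc.le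
  have : y ≠ 0 := by rintro rfl; simp at hc
  rw [map_pow]
  have : algebraMap F R y ≠ 0 := (_root_.map_ne_zero _).2 this
  positivity

theorem rc_sign_map (c : F) : SignType.sign (algebraMap F R c) = SignType.sign c := by
  rcases lt_trichotomy c 0 with h | rfl | h
  · have := rc_map_pos (R := R) (neg_pos.2 h)
    rw [map_neg, neg_pos] at this
    rw [sign_neg h, sign_neg this]
  · simp
  · rw [sign_pos h, sign_pos (rc_map_pos h)]

theorem quad_irred (a b : F) (hb : b ≠ 0) : Irreducible ((X - C a) ^ 2 + C (b ^ 2) : F[X]) := by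
  have hdeg : ((X - C a) ^ 2 + C (b ^ 2) : F[X]).natDegree = 2 := by compute_degree!
  apply Polynomial.irreducible_of_degree_le_three_of_not_isRoot
  · rw [hdeg]; simp
  · intro x hx
    simp only [IsRoot, eval_add, eval_pow, eval_sub, eval_X, eval_C] at hx
    have : 0 < b ^ 2 := by positivity
    nlinarith [sq_nonneg (x - a)]

theorem irred_form {p : F[X]} (hp : Irreducible p) : ∃ c a : F, c ≠ 0 ∧
    (p = C c * (X - C a) ∨ ∃ b : F, b ≠ 0 ∧ p = C c * ((X - C a) ^ 2 + C (b ^ 2))) := by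
  obtain ⟨z, hz⟩ := IsAlgClosed.exists_aeval_eq_zero (Cx F) p (Polynomial.degree_pos_of_irreducible hp).ne'
  have h1 := minpoly.eq_of_irreducible hp hz
  have hlc : p.leadingCoeff ≠ 0 := leadingCoeff_ne_zero.2 hp.ne_zero
  have h2 : p = C p.leadingCoeff * minpoly F z := by
    rw [← h1, mul_comm, mul_assoc, ← C_mul, inv_mul_cancel₀ hlc, C_1, mul_one]
  refine ⟨p.leadingCoeff, z.re, hlc, ?_⟩
  by_cases hb : z.im = 0
  · left
    have : z = algebraMap F (Cx F) z.re := by ext <;> simp [hb]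
    rw [this, minpoly.eq_X_sub_C] at h2
    exact h2
  · right
    refine ⟨z.im, hb, ?_⟩
    rw [minpoly.eq_of_irreducible_of_monic (quad_irred z.re z.im hb) (x := z)]
    · exact h2
    · simp only [map_add, map_pow, map_sub, aeval_X, aeval_C]
      rw [sq]
      ext <;> simp [sq] <;> ring
    · monicity!

theorem alg_mem {z : R} (hz : IsAlgebraic F z) : ∃ a : F, algebraMap F R a = z := by
  have hi := minpoly.irreducible hz.isIntegral
  have h0 := minpoly.aeval F z
  obtain ⟨c, a, hc, h | ⟨b, hb, h⟩⟩ := irred_form hi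
  · rw [h] at h0
    simp [hc, sub_eq_zero] at h0
    exact ⟨a, h0.symm⟩
  · rw [h] at h0
    simp [hc] at h0
    have : algebraMap F R b ≠ 0 := (_root_.map_ne_zero _).2 hb
    have : 0 < algebraMap F R b ^ 2 := by positivity
    nlinarith [sq_nonneg (z - algebraMap F R a)]

def cutFilter (F : Type*) [Field F] [LinearOrder F] {R : Type*} [Field R] [LinearOrder R] [Algebra F R]
    (y : R) : Filter F :=
  Filter.generate (Set.range fun c : F => {x : F | SignType.sign (x - c) = SignType.sign (y - algebraMap F R c)})

theorem cutFilter_neBot (y : R) (hy : ∀ a : F, algebraMap F R a ≠ y) : (cutFilter F y).NeBot := by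
  classical
  rw [cutFilter, Filter.generate_neBot_iff]
  intro t ht hf
  obtain ⟨T, -, hT, h⟩ := Set.exists_subset_image_finite_and.1
    ⟨t, by rwa [Set.image_univ], hf, (rfl : t = t)⟩
  obtain ⟨m, h1, h2⟩ := Order.exists_between_finsets
    (hT.toFinset.filter fun c => algebraMap F R c < y) (hT.toFinset.filter fun c => y < algebraMap F R c) (by
      intro a ha b hb
      have := (Finset.mem_filter.1 ha).2.trans (Finset.mem_filter.1 hb).2
      by_contra hab
      push Not at hab
      rcases hab.lt_or_eq with hab | hab
      · have h3 := rc_map_pos (R := R) (sub_pos.2 hab)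
        rw [map_sub] at h3
        linarith
      · rw [hab] at this; exact lt_irrefl _ this)
  refine ⟨m, ?_⟩
  rw [h]
  rintro _ ⟨c, hc, rfl⟩
  simp only [Set.mem_setOf_eq]
  rcases lt_or_gt_of_ne (hy c) with hh | hh
  · rw [sign_pos (sub_pos.2 hh), sign_pos (sub_pos.2 (h1 c (by simp [hc, hh])))]
  · rw [sign_neg (sub_neg.2 hh), sign_neg (sub_neg.2 (h2 c (by simp [hc, hh])))]

theorem cut_sign (y : R) (hy : ∀ a : F, algebraMap F R a ≠ y) (d : F[X]) (hd : d ≠ 0) :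
    aeval y d ≠ 0 ∧ ∀ᶠ x in cutFilter F y, SignType.sign (d.eval x) = SignType.sign (aeval y d) := by
  induction d using WfDvdMonoid.induction_on_irreducible with
  | zero => exact absurd rfl hd
  | unit u hu =>
    obtain ⟨c, hc, rfl⟩ := Polynomial.isUnit_iff.1 hu
    refine ⟨by simpa using hc.ne_zero, Filter.Eventually.of_forall fun x => ?_⟩
    simp [rc_sign_map]
  | mul a i ha hi ih =>
    obtain ⟨h1, h2⟩ := ih ha
    have key : aeval y i ≠ 0 ∧ ∀ᶠ x in cutFilter F y, SignType.sign (i.eval x) = SignType.sign (aeval y i) := by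
      obtain ⟨c, e, hc, h | ⟨b, hb, h⟩⟩ := irred_form hi
      · subst h
        refine ⟨by simpa [hc, sub_eq_zero] using (hy e).symm, ?_⟩
        have : {x : F | SignType.sign (x - e) = SignType.sign (y - algebraMap F R e)} ∈ cutFilter F y :=
          Filter.mem_generate_of_mem ⟨e, rfl⟩
        filter_upwards [this] with x hx
        have hx' : SignType.sign (x - e) = SignType.sign (y - algebraMap F R e) := hx
        simp [sign_mul, hx', rc_sign_map]
      · subst h
        have h1 : ∀ z : R, 0 < (z - algebraMap F R e) ^ 2 + (algebraMap F R b) ^ 2 := by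
          intro z
          have : algebraMap F R b ≠ 0 := (_root_.map_ne_zero _).2 hb
          positivity
        have h2 : ∀ z : F, 0 < (z - e) ^ 2 + b ^ 2 := by
          intro z
          positivity
        refine ⟨by simpa [hc] using (h1 y).ne', Filter.Eventually.of_forall fun x => ?_⟩
        have e1 := sign_pos (h1 y)
        have e2 := sign_pos (h2 x)
        simp only [eval_mul, eval_add, eval_pow, eval_sub, eval_X, eval_C, map_add, map_mul, map_pow, map_sub, aeval_X, aeval_C, sign_mul, rc_sign_map, e1, e2]
    refine ⟨by rw [map_mul]; exact mul_ne_zero key.1 h1, ?_⟩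
    filter_upwards [h2, key.2] with x e1 e2
    rw [eval_mul, map_mul (aeval y), sign_mul, sign_mul, e1, e2]
end SignL

end Part3

section Part4

open Polynomial
open scoped QuadraticAlgebra

section Ultra
variable {α : Type*} {F : Type*} [Field F] [LinearOrder F] [IsStrictOrderedRing F] [IsRealClosed F]

theorem germ_poly_eval (φ : Ultrafilter α) (n : ℕ) (c : ℕ → α → F) (r : α → F) :
    ∑ i ∈ Finset.range n, (((c i : α → F) : Filter.Germ (φ : Filter α) F)) * ((r : Filter.Germ (φ : Filter α) F)) ^ i
      = ((fun x => ∑ i ∈ Finset.range n, c i x * r x ^ i : α → F) : Filter.Germ (φ : Filter α) F) := by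
  induction n with
  | zero => simp; rfl
  | succ n ih => rw [Finset.sum_range_succ, ih]; simp_rw [Finset.sum_range_succ]; rfl

theorem germ_rc (φ : Ultrafilter α) : IsRealClosed (Filter.Germ (φ : Filter α) F) := by
  refine IsRealClosed.of_linearOrderedField ?_ ?_
  · intro x hx
    induction x using Filter.Germ.inductionOn with | _ f =>
    have hx' : ∀ᶠ a in (φ : Filter α), 0 ≤ f a := Filter.Germ.coe_nonneg.1 hx
    choose g hg using fun a => (em (0 ≤ f a)).elim
      (fun h => let ⟨y, _, hy⟩ := rc_sqrt h; (⟨y, fun _ => hy⟩ : ∃ y, 0 ≤ f a → y ^ 2 = f a))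
      (fun h => ⟨0, fun h' => absurd h' h⟩)
    refine ⟨(g : Filter.Germ (φ : Filter α) F), ?_⟩
    rw [← Filter.Germ.coe_mul]
    apply Filter.Germ.coe_eq.2
    filter_upwards [hx'] with a ha
    rw [Pi.mul_apply, ← sq, hg a ha]
  · intro p hp
    have hc : ∀ i, ∃ c : α → F, (c : Filter.Germ (φ : Filter α) F) = p.coeff i := fun i =>
      Filter.Germ.inductionOn (p.coeff i) fun f => ⟨f, rfl⟩
    choose c hc using hc
    set n := p.natDegree
    let q : α → F[X] := fun x => ∑ i ∈ Finset.range (n + 1), C (c i x) * X ^ i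
    have hqn : ∀ x, (q x).coeff n = c n x := by
      intro x
      simp [q, coeff_X_pow]
    have hqd : ∀ x, c n x ≠ 0 → (q x).natDegree = n := by
      intro x hx
      apply le_antisymm
      · apply Polynomial.natDegree_sum_le_of_forall_le
        intro i hi
        exact (natDegree_C_mul_X_pow_le _ _).trans (by simpa [Nat.lt_succ_iff] using hi)
      · exact le_natDegree_of_ne_zero (by rwa [hqn])
    have hex : ∀ x, ∃ r, c n x ≠ 0 → (q x).eval r = 0 := by
      intro x
      by_cases h : c n x = 0
      · exact ⟨0, fun h' => absurd h h'⟩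
      · obtain ⟨r, hr⟩ := IsRealClosed.exists_isRoot_of_odd_natDegree (f := q x) (by rwa [hqd x h])
        exact ⟨r, fun _ => hr⟩
    choose r hr using hex
    have hcn : ∀ᶠ x in (φ : Filter α), c n x ≠ 0 := by
      rw [Ultrafilter.eventually_not]
      intro h0
      have h1 : (c n : Filter.Germ (φ : Filter α) F) = ((0 : α → F) : Filter.Germ (φ : Filter α) F) := Filter.Germ.coe_eq.2 h0
      rw [hc] at h1
      have h2 : p.leadingCoeff = 0 := h1
      rw [leadingCoeff_eq_zero] at h2
      have h3 : n = 0 := by simp [n, h2]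
      rw [h3] at hp
      simp at hp
    refine ⟨(r : Filter.Germ (φ : Filter α) F), ?_⟩
    rw [IsRoot, eval_eq_sum_range]
    simp_rw [← hc]
    rw [germ_poly_eval]
    have : ((0 : α → F) : Filter.Germ (φ : Filter α) F) = 0 := rfl
    rw [← this]
    apply Filter.Germ.coe_eq.2
    filter_upwards [hcn] with x hx
    have := hr x hx
    simpa [q, eval_finset_sum] using this
end Ultra

end Part4

section Part5

open Polynomial
open scoped QuadraticAlgebra IntermediateField

section Step
variable {F : Type*} [Field F] [LinearOrder F] [IsStrictOrderedRing F] [IsRealClosed F]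
variable {R : Type*} [Field R] [LinearOrder R] [IsStrictOrderedRing R] [Algebra F R]

noncomputable def germPoly (U : Ultrafilter F) : F[X] →+* Filter.Germ (U : Filter F) F :=
  (Filter.Germ.coeRingHom (U : Filter F)).comp (eval₂RingHom (Pi.constRingHom F F) id)

theorem germPoly_apply (U : Ultrafilter F) (d : F[X]) :
    germPoly U d = ((fun x => d.eval x : F → F) : Filter.Germ (U : Filter F) F) := by
  have : eval₂RingHom (Pi.constRingHom F F) id d = fun x => d.eval x := by
    ext x
    have := Polynomial.hom_eval₂ d (Pi.constRingHom F F) (Pi.evalRingHom (fun _ : F => F) x) id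
    simp only [coe_eval₂RingHom]
    exact this
  rw [germPoly, RingHom.comp_apply, this]
  rfl

theorem exists_theta (y : R) (hy : ∀ a : F, algebraMap F R a ≠ y) (U : Ultrafilter F)
    (hU : (U : Filter F) ≤ cutFilter F y) :
    ∃ θ : F⟮y⟯ →+* Filter.Germ (U : Filter F) F,
      (∀ d : F[X], θ (aeval (IntermediateField.AdjoinSimple.gen F y) d) = germPoly U d) ∧
      ∀ x : F⟮y⟯, 0 < (x : R) → 0 < θ x := by
  have htr : Transcendental F y := by
    intro h
    obtain ⟨a, ha⟩ := alg_mem h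
    exact hy a ha
  have hne : ∀ d : F[X], d ≠ 0 → germPoly U d ≠ 0 := by
    intro d hd h0
    obtain ⟨h1, h2⟩ := cut_sign y hy d hd
    rw [germPoly_apply] at h0
    have h3 : ∀ᶠ x in (U : Filter F), d.eval x = 0 := Filter.Germ.coe_eq.1 h0
    obtain ⟨x, e1, e2⟩ := (h3.and (hU h2)).exists
    rw [e1, sign_zero] at e2
    exact h1 (sign_eq_zero_iff.1 e2.symm)
  have hinj : Function.Injective (germPoly U) := by
    rw [injective_iff_map_eq_zero]
    intro d hd
    by_contra h
    exact hne d h hd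
  let e := RatFunc.algEquivOfTranscendental y htr
  let θ : F⟮y⟯ →+* Filter.Germ (U : Filter F) F :=
    (IsFractionRing.lift (K := RatFunc F) hinj).comp (e.symm : F⟮y⟯ →+* RatFunc F)
  have hθ : ∀ d : F[X], θ (aeval (IntermediateField.AdjoinSimple.gen F y) d) = germPoly U d := by
    intro d
    have : e.symm (aeval (IntermediateField.AdjoinSimple.gen F y) d) = algebraMap F[X] (RatFunc F) d := by
      rw [AlgEquiv.symm_apply_eq]
      apply Subtype.ext
      simp [e]
    simp only [θ, RingHom.comp_apply]
    erw [this]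
    exact IsFractionRing.lift_algebraMap hinj d
  refine ⟨θ, hθ, ?_⟩
  intro x hx
  obtain ⟨r, s, hrs⟩ := (IntermediateField.mem_adjoin_simple_iff F _).1 x.2
  have hs : aeval y s ≠ 0 := by
    intro h; rw [h, div_zero] at hrs; rw [hrs] at hx; exact lt_irrefl _ hx
  have hs0 : s ≠ 0 := by rintro rfl; simp at hs
  have hx2 : (x : R) * aeval y s ^ 2 = aeval y (r * s) := by
    rw [hrs, map_mul]; field_simp
  have hx3 : x * aeval (IntermediateField.AdjoinSimple.gen F y) s ^ 2 =
      aeval (IntermediateField.AdjoinSimple.gen F y) (r * s) := by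
    apply Subtype.ext
    have : ∀ d : F[X], ((aeval (IntermediateField.AdjoinSimple.gen F y) d : F⟮y⟯) : R) = aeval y d := by
      intro d
      have := Polynomial.aeval_algebraMap_apply R (IntermediateField.AdjoinSimple.gen F y) d
      simpa using this.symm
    push_cast [this]
    exact hx2
  have hpos : 0 < aeval y (r * s) := by
    rw [← hx2]; positivity
  have hd0 : r * s ≠ 0 := by intro h; rw [h] at hpos; simp at hpos
  have h1 : 0 < germPoly U (r * s) := by
    rw [germPoly_apply]
    have : ((fun x => 0 : F → F) : Filter.Germ (U : Filter F) F) = 0 := rfl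
    rw [← this, Filter.Germ.coe_lt]
    filter_upwards [hU (cut_sign y hy _ hd0).2] with x hx
    rw [sign_pos hpos] at hx
    exact sign_eq_one_iff.1 hx
  rw [← hθ, ← hx3, map_mul, map_pow, hθ] at h1
  have h2 : 0 < germPoly U s ^ 2 := by
    have := hne s hs0
    positivity
  exact (pos_iff_pos_of_mul_pos h1).2 h2

theorem germ_mv {σ : Type*} (U : Ultrafilter F) (W : σ → F → F) (g : MvPolynomial σ F) :
    MvPolynomial.eval₂ ((Filter.Germ.coeRingHom (U : Filter F)).comp (Pi.constRingHom F F))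
      (fun j => ((W j : F → F) : Filter.Germ (U : Filter F) F)) g =
      ((fun x => MvPolynomial.eval (fun j => W j x) g : F → F) : Filter.Germ (U : Filter F) F) := by
  have : MvPolynomial.eval₂ (Pi.constRingHom F F) W g = fun x => MvPolynomial.eval (fun j => W j x) g := by
    ext x
    have := MvPolynomial.hom_eval₂ g (Pi.constRingHom F F) (Pi.evalRingHom (fun _ : F => F) x) W
    exact this
  have h2 := MvPolynomial.hom_eval₂ g (Pi.constRingHom F F) (Filter.Germ.coeRingHom (U : Filter F)) W
  rw [this] at h2
  exact h2.symm

theorem one_step [IsRealClosed R] {σ : Type*} [Finite σ] (y : R) (hy : ∀ a : F, algebraMap F R a ≠ y)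
    (w : σ → R) (hw : ∀ j, IsAlgebraic F⟮y⟯ (w j)) (J : Finset (MvPolynomial σ F))
    (hJ : ∀ g ∈ J, MvPolynomial.aeval w g = 0) :
    ∃ w' : σ → F, ∀ g ∈ J, MvPolynomial.eval w' g = 0 := by
  haveI := cutFilter_neBot y hy
  let U := Ultrafilter.of (cutFilter F y)
  obtain ⟨θ, hθ, hpos⟩ := exists_theta y hy U (Ultrafilter.of_le _)
  letI : Algebra F⟮y⟯ (Filter.Germ (U : Filter F) F) := θ.toAlgebra
  let E := IntermediateField.adjoin F⟮y⟯ (Set.range w)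
  haveI : FiniteDimensional F⟮y⟯ E := IntermediateField.finiteDimensional_adjoin (by
    rintro _ ⟨j, rfl⟩; exact (hw j).isIntegral)
  haveI := germ_rc (F := F) U
  haveI : CharZero F⟮y⟯ := charZero_of_injective_algebraMap (algebraMap F F⟮y⟯).injective
  obtain ⟨ψ⟩ := transfer (k := F⟮y⟯) (E := E) (R := R) (R' := Filter.Germ (U : Filter F) F)
    (fun x hx => hpos x hx) E.val
  let wE : σ → E := fun j => ⟨w j, IntermediateField.subset_adjoin _ _ ⟨j, rfl⟩⟩
  have hW : ∀ j, ∃ W : F → F, (W : Filter.Germ (U : Filter F) F) = ψ (wE j) := fun j =>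
    Filter.Germ.inductionOn (ψ (wE j)) fun f => ⟨f, rfl⟩
  choose W hW using hW
  have hconst : ∀ c : F, θ (algebraMap F F⟮y⟯ c) = ((Filter.Germ.coeRingHom (U : Filter F)).comp (Pi.constRingHom F F)) c := by
    intro c
    have := hθ (C c)
    rw [aeval_C] at this
    rw [this, germPoly_apply]
    simp only [eval_C]
    rfl
  have key : ∀ g ∈ J, ∀ᶠ x in (U : Filter F), MvPolynomial.eval (fun j => W j x) g = 0 := by
    intro g hg
    have h1 : MvPolynomial.eval₂ ((algebraMap F⟮y⟯ E).comp (algebraMap F F⟮y⟯)) wE g = 0 := by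
      apply E.val.injective
      rw [map_zero, ← hJ g hg, MvPolynomial.aeval_def]
      exact MvPolynomial.hom_eval₂ g _ (E.val : E →+* R) wE
    have h2 := congrArg ψ h1
    rw [map_zero] at h2
    have h3 : MvPolynomial.eval₂ ((Filter.Germ.coeRingHom (U : Filter F)).comp (Pi.constRingHom F F))
      (fun j => ((W j : F → F) : Filter.Germ (U : Filter F) F)) g = 0 := by
      rw [← h2]
      refine Eq.trans ?_ (MvPolynomial.hom_eval₂ g ((algebraMap F⟮y⟯ E).comp (algebraMap F F⟮y⟯)) ψ.toRingHom wE).symm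
      congr 1
      · ext c
        rw [← hconst]
        exact (ψ.commutes (algebraMap F F⟮y⟯ c)).symm
      · ext j; exact hW j
    rw [germ_mv] at h3
    exact Filter.Germ.coe_eq.1 h3
  obtain ⟨x, hx⟩ := ((Filter.eventually_all_finset J).2 key).exists
  exact ⟨fun j => W j x, hx⟩
end Step

end Part5

section Part6

open Polynomial
open scoped QuadraticAlgebra IntermediateField

section Descent

theorem real_odd_pos (p : ℝ[X]) (hp : Odd p.natDegree) (hl : 0 < p.leadingCoeff) : ∃ x, p.IsRoot x := by
  have hd : 0 < p.degree := by
    rw [← natDegree_pos_iff_degree_pos]; exact hp.pos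
  have h1 := p.tendsto_atTop_of_leadingCoeff_nonneg hd hl.le
  have hnd : (p.comp (-X)).natDegree = p.natDegree := by rw [natDegree_comp]; simp
  have hl2 : (p.comp (-X)).leadingCoeff = - p.leadingCoeff := by
    rw [leadingCoeff_comp (by simp)]
    simp [hp.neg_one_pow]
  have h2 := (p.comp (-X)).tendsto_atBot_of_leadingCoeff_nonpos
    (by rw [← natDegree_pos_iff_degree_pos, hnd]; exact hp.pos) (by rw [hl2]; linarith)
  have h3 : Filter.Tendsto (fun x => p.eval x) Filter.atBot Filter.atBot := by
    have := h2.comp Filter.tendsto_neg_atBot_atTop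
    refine this.congr fun x => ?_
    simp
  exact p.continuous.surjective h1 h3 0

instance real_rc : IsRealClosed ℝ := by
  refine IsRealClosed.of_linearOrderedField ?_ ?_
  · intro x hx; exact ⟨√x, (Real.mul_self_sqrt hx).symm⟩
  · intro p hp
    have : p.leadingCoeff ≠ 0 := by
      rw [leadingCoeff_ne_zero]; rintro rfl; simp at hp
    rcases lt_or_gt_of_ne this with h | h
    · obtain ⟨x, hx⟩ := real_odd_pos (-p) (by simpa using hp) (by simpa using h)
      exact ⟨x, by simpa using hx⟩
    · exact real_odd_pos p hp h

variable {R : Type*} [Field R] [LinearOrder R] [IsStrictOrderedRing R] [IsRealClosed R]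

theorem relclosed_rc {F : Type*} [Field F] [LinearOrder F] [IsStrictOrderedRing F] [Algebra F R]
    (hm : ∀ x : F, 0 ≤ x → 0 ≤ algebraMap F R x)
    (hF : ∀ z : R, IsAlgebraic F z → ∃ a, algebraMap F R a = z) : IsRealClosed F := by
  refine IsRealClosed.of_linearOrderedField ?_ ?_
  · intro x hx
    obtain ⟨y, _, hy⟩ := rc_sqrt (hm x hx)
    obtain ⟨a, ha⟩ := hF y (IsAlgebraic.of_pow two_pos (hy ▸ isAlgebraic_algebraMap x))
    refine ⟨a, (algebraMap F R).injective ?_⟩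
    rw [map_mul, ha, ← sq, hy]
  · intro p hp
    obtain ⟨r, hr⟩ := IsRealClosed.exists_isRoot_of_odd_natDegree (f := p.map (algebraMap F R)) (by simpa using hp)
    have hr' : aeval r p = 0 := by rwa [IsRoot, eval_map_algebraMap] at hr
    obtain ⟨a, ha⟩ := hF r ⟨p, by rintro rfl; simp at hp, hr'⟩
    refine ⟨a, ?_⟩
    rw [← ha, aeval_algebraMap_apply] at hr'
    exact (algebraMap F R).injective (by rw [map_zero]; simpa using hr')

theorem alg_of_range {A B R : Type*} [Field A] [Field B] [Field R] [Algebra A R] [Algebra B R]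
    (h : ∀ a : A, algebraMap A R a ∈ Set.range (algebraMap B R)) {z : R} (hz : IsAlgebraic A z) :
    IsAlgebraic B z := by
  obtain ⟨p, hp, hpz⟩ := hz
  have : p.map (algebraMap A R) ∈ lifts (algebraMap B R) := by
    rw [lifts_iff_coeff_lifts]; intro n; rw [coeff_map]; exact h _
  obtain ⟨q, hq⟩ := (mem_lifts _).1 this
  refine ⟨q, ?_, ?_⟩
  · rintro rfl
    rw [Polynomial.map_zero] at hq
    exact hp ((Polynomial.map_eq_zero _).1 hq.symm)
  · rw [← eval_map_algebraMap, hq, eval_map_algebraMap, hpz]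

theorem adjoin_range {B : Type*} [Field B] [Algebra ℝ R] [Algebra B R] (S : Set R)
    (h1 : ∀ r : ℝ, algebraMap ℝ R r ∈ Set.range (algebraMap B R))
    (h2 : ∀ s ∈ S, s ∈ Set.range (algebraMap B R)) (x : R) (hx : x ∈ IntermediateField.adjoin ℝ S) :
    x ∈ Set.range (algebraMap B R) := by
  induction hx using IntermediateField.adjoin_induction with
  | mem x hx => exact h2 x hx
  | algebraMap r => exact h1 r
  | add x y _ _ ha hb => obtain ⟨a, rfl⟩ := ha; obtain ⟨b, rfl⟩ := hb; exact ⟨a + b, map_add _ _ _⟩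
  | inv x _ ha => obtain ⟨a, rfl⟩ := ha; exact ⟨a⁻¹, map_inv₀ _ _⟩
  | mul x y _ _ ha hb => obtain ⟨a, rfl⟩ := ha; obtain ⟨b, rfl⟩ := hb; exact ⟨a * b, map_mul _ _ _⟩

theorem descent [Algebra ℝ R] {σ : Type*} [Finite σ] (J : Finset (MvPolynomial σ ℝ)) (S : Finset R) :
    ∀ (w : σ → R), (∀ j, IsAlgebraic (IntermediateField.adjoin ℝ (S : Set R)) (w j)) →
    (∀ g ∈ J, MvPolynomial.aeval w g = 0) → ∃ w' : σ → ℝ, ∀ g ∈ J, MvPolynomial.eval w' g = 0 := by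
  classical
  induction S using Finset.induction_on with
  | empty =>
    intro w hw hJ
    have : ∀ j, ∃ a : ℝ, algebraMap ℝ R a = w j := by
      intro j
      apply alg_mem
      refine alg_of_range (B := ℝ) ?_ (hw j)
      rintro ⟨a, ha⟩
      exact adjoin_range _ (fun r => ⟨r, rfl⟩) (by simp) a ha
    choose w' hw' using this
    refine ⟨w', fun g hg => (algebraMap ℝ R).injective ?_⟩
    have h1 := hJ g hg
    rw [map_zero, ← h1, show w = fun j => algebraMap ℝ R (w' j) from (funext hw').symm]
    exact (MvPolynomial.aeval_algebraMap_apply R w' g).symm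
  | insert y S hyS ih =>
    intro w hw hJ
    let A := IntermediateField.adjoin ℝ (S : Set R)
    let F := algebraicClosure A R
    have hF : ∀ z : R, IsAlgebraic F z → ∃ a, algebraMap F R a = z := by
      intro z hz
      exact ⟨⟨z, mem_algebraicClosure_iff.2 (hz.restrictScalars A)⟩, rfl⟩
    haveI : IsRealClosed F := relclosed_rc (R := R) (fun x hx => hx) hF
    let i : ℝ →+* F := (algebraMap A F).comp (algebraMap ℝ A)
    have hi : (algebraMap F R).comp i = algebraMap ℝ R := rfl
    have hSF : ∀ s ∈ S, s ∈ Set.range (algebraMap F R) := by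
      intro s hs
      exact ⟨algebraMap A F ⟨s, IntermediateField.subset_adjoin _ _ hs⟩, rfl⟩
    by_cases hy : ∃ a : F, algebraMap F R a = y
    · refine ih w (fun j => ?_) hJ
      have : IsAlgebraic F (w j) := by
        refine alg_of_range ?_ (hw j)
        rintro ⟨a, ha⟩
        refine adjoin_range _ (fun r => ⟨i r, rfl⟩) ?_ a ha
        intro s hs
        rw [Finset.coe_insert] at hs
        rcases hs with rfl | hs
        · exact hy
        · exact hSF s hs
      exact this.restrictScalars A
    · push Not at hy
      obtain ⟨w', hw'⟩ := one_step (F := F) y hy w (fun j => by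
        refine alg_of_range ?_ (hw j)
        rintro ⟨a, ha⟩
        refine adjoin_range _ (fun r => ⟨algebraMap F F⟮y⟯ (i r), rfl⟩) ?_ a ha
        intro s hs
        rw [Finset.coe_insert] at hs
        rcases hs with rfl | hs
        · exact ⟨IntermediateField.AdjoinSimple.gen F s, rfl⟩
        · obtain ⟨a, rfl⟩ := hSF s hs
          exact ⟨algebraMap F F⟮y⟯ a, rfl⟩) (J.image (MvPolynomial.map i)) (by
        intro g hg
        obtain ⟨g, hg', rfl⟩ := Finset.mem_image.1 hg
        rw [MvPolynomial.aeval_def, MvPolynomial.eval₂_map, hi]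
        exact hJ g hg')
      refine ih (fun j => (w' j : R)) (fun j => mem_algebraicClosure_iff.1 (w' j).2) ?_
      intro g hg
      have h1 := hw' _ (Finset.mem_image_of_mem _ hg)
      rw [MvPolynomial.eval_map] at h1
      have h2 := MvPolynomial.hom_eval₂ g i (algebraMap F R) w'
      rw [h1, map_zero] at h2
      exact h2.symm
end Descent

end Part6

section Part7

open Polynomial
open scoped QuadraticAlgebra

section SR
universe u

theorem sumSq_map {A B : Type*} [CommRing A] [CommRing B] (φ : A →+* B) {x : A} (h : IsSumSq x) :
    IsSumSq (φ x) := by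
  induction h with
  | zero => rw [map_zero]; exact IsSumSq.zero
  | sq_add a hs ih => rw [map_add, map_mul]; exact IsSumSq.sq_add _ ih

def MaxSR (M : Type u) [Field M] : Prop := ¬ IsSumSq (-1 : M) ∧
  ∀ (N : Type u) [Field N] [Algebra M N] [Algebra.IsAlgebraic M N], ¬ IsSumSq (-1 : N) →
    Function.Surjective (algebraMap M N)

theorem sumSq_inv {M : Type*} [Field M] {x : M} (h : IsSumSq x) : IsSumSq x⁻¹ := by
  by_cases hx : x = 0
  · rw [hx, inv_zero]; exact IsSumSq.zero
  · have : x⁻¹ = x * (x⁻¹ * x⁻¹) := by field_simp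
    rw [this]; exact h.mul (IsSumSq.mul_self _)

theorem sr_add {M : Type*} [Field M] (hM : ¬ IsSumSq (-1 : M)) {x y : M} (hx : IsSumSq x) (hy : IsSumSq y)
    (h : x + y = 0) : x = 0 := by
  by_contra h0
  apply hM
  have : (-1 : M) = y * x⁻¹ := by
    rw [eq_neg_of_add_eq_zero_right h]; field_simp
  rw [this]; exact hy.mul (sumSq_inv hx)

theorem quad_sumSq {M : Type*} [Field M] (a : M) {z : QuadraticAlgebra M a 0} (h : IsSumSq z) :
    ∃ S T : M, IsSumSq S ∧ IsSumSq T ∧ z.re = S + a * T := by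
  induction h with
  | zero => exact ⟨0, 0, IsSumSq.zero, IsSumSq.zero, by simp⟩
  | sq_add w hs ih =>
    obtain ⟨S, T, hS, hT, h⟩ := ih
    refine ⟨w.re * w.re + S, w.im * w.im + T, IsSumSq.sq_add _ hS, IsSumSq.sq_add _ hT, ?_⟩
    rw [QuadraticAlgebra.re_add, QuadraticAlgebra.re_mul, h]; ring

theorem maxSR_sq {M : Type u} [Field M] (hM : MaxSR M) (a : M) (ha : ¬ IsSquare a) : IsSumSq (-a) := by
  haveI : Fact (∀ r : M, r ^ 2 ≠ a + 0 * r) := ⟨fun r hr => ha ⟨r, by rw [← sq, hr]; ring⟩⟩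
  by_cases h : IsSumSq (-1 : QuadraticAlgebra M a 0)
  · obtain ⟨S, T, hS, hT, h⟩ := quad_sumSq a h
    have h' : -1 = S + a * T := by simpa using h
    have hT0 : T ≠ 0 := by
      rintro rfl
      apply hM.1; rw [h']; simpa using hS
    have : -a = (1 + S) * T⁻¹ := by
      field_simp; linear_combination h'
    rw [this]
    exact (IsSumSq.one.add hS).mul (sumSq_inv hT)
  · exfalso
    haveI : FiniteDimensional M (QuadraticAlgebra M a 0) := inferInstance
    obtain ⟨r, hr⟩ := hM.2 (QuadraticAlgebra M a 0) h ⟨0, 1⟩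
    have := congrArg QuadraticAlgebra.im hr
    simp at this

theorem maxSR_isSquare {M : Type u} [Field M] (hM : MaxSR M) {a : M} (ha : IsSumSq a) : IsSquare a := by
  by_contra h
  have h1 := maxSR_sq hM a h
  have h0 := sr_add hM.1 ha h1 (by ring)
  apply h; rw [h0]; exact IsSquare.zero

theorem maxSR_or {M : Type u} [Field M] (hM : MaxSR M) (a : M) : IsSquare a ∨ IsSquare (-a) := by
  by_cases h : IsSquare a
  · exact Or.inl h
  · exact Or.inr (maxSR_isSquare hM (maxSR_sq hM a h))

theorem poly_sumSq {M : Type*} [Field M] (hM : ¬ IsSumSq (-1 : M)) {S : M[X]} (h : IsSumSq S) :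
    S = 0 ∨ (Even S.natDegree ∧ IsSumSq S.leadingCoeff) := by
  induction h with
  | zero => exact Or.inl rfl
  | @sq_add f S hs ih =>
    by_cases hf : f = 0
    · subst hf; simpa using ih
    rcases ih with rfl | ⟨h1, h2⟩
    · right; simp [natDegree_mul hf hf]
    by_cases hS : S = 0
    · subst hS; right; simp [natDegree_mul hf hf]
    right
    have hff : (f * f).natDegree = f.natDegree + f.natDegree := natDegree_mul hf hf
    have hff0 : f * f ≠ 0 := mul_ne_zero hf hf
    rcases lt_trichotomy (f * f).natDegree S.natDegree with h | h | h
    · rw [natDegree_add_eq_right_of_natDegree_lt h, leadingCoeff_add_of_degree_lt (degree_lt_degree h)]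
      exact ⟨h1, h2⟩
    · have hne : (f * f).leadingCoeff + S.leadingCoeff ≠ 0 := by
        intro h0
        have := sr_add hM (by rw [leadingCoeff_mul]; exact IsSumSq.mul_self _) h2 h0
        exact hff0 (leadingCoeff_eq_zero.1 this)
      have hdeg : (f * f).degree = S.degree := by
        rw [degree_eq_natDegree hff0, degree_eq_natDegree hS, h]
      have hl := leadingCoeff_add_of_degree_eq hdeg hne
      have hn : (f * f + S).natDegree = S.natDegree := by
        apply le_antisymm
        · refine (natDegree_add_le _ _).trans ?_; rw [h, max_self]
        · apply le_natDegree_of_ne_zero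
          rw [coeff_add]; 
          nth_rewrite 1 [← h]; exact hne
      rw [hn, hl, leadingCoeff_mul]
      exact ⟨h1, IsSumSq.sq_add _ h2⟩
    · rw [natDegree_add_eq_left_of_natDegree_lt h, leadingCoeff_add_of_degree_lt' (degree_lt_degree h), hff, leadingCoeff_mul]
      exact ⟨⟨_, rfl⟩, IsSumSq.mul_self _⟩

theorem adj_sumSq {M : Type*} [Field M] (P : M[X]) (hP : 0 < P.natDegree) {s : AdjoinRoot P} (h : IsSumSq s) :
    ∃ S : M[X], IsSumSq S ∧ S.natDegree ≤ 2 * (P.natDegree - 1) ∧ AdjoinRoot.mk P S = s := by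
  induction h with
  | zero => exact ⟨0, IsSumSq.zero, by simp, map_zero _⟩
  | sq_add a hs ih =>
    obtain ⟨S, h1, h2, h3⟩ := ih
    obtain ⟨f, rfl⟩ := AdjoinRoot.mk_surjective a
    have hP0 : P ≠ 0 := by rintro rfl; simp at hP
    have hf : AdjoinRoot.mk P (f % P) = AdjoinRoot.mk P f := by
      rw [AdjoinRoot.mk_eq_mk]
      exact ⟨-(f / P), by linear_combination EuclideanDomain.div_add_mod f P⟩
    refine ⟨(f % P) * (f % P) + S, IsSumSq.sq_add _ h1, ?_, ?_⟩
    · refine natDegree_add_le_of_degree_le ?_ h2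
      refine natDegree_mul_le.trans ?_
      have := natDegree_mod_lt f hP.ne'
      omega
    · rw [map_add, map_mul, hf, h3]

theorem odd_sr {M : Type*} [Field M] (hM : ¬ IsSumSq (-1 : M)) (d : ℕ) : ∀ P : M[X], P.natDegree = d →
    Odd d → ¬ IsSumSq (-1 : AdjoinRoot P) := by
  induction d using Nat.strong_induction_on with
  | _ d ih =>
    intro P hd hodd h
    obtain ⟨S, h1, h2, h3⟩ := adj_sumSq P (hd ▸ hodd.pos) h
    have h4 : P ∣ 1 + S := by
      rw [← AdjoinRoot.mk_eq_zero, map_add, h3]; simp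
    obtain ⟨Q, hQ⟩ := h4
    have hne : 1 + S ≠ 0 := by
      intro h0
      apply hM
      have := sumSq_map (evalRingHom (0 : M)) h1
      rw [eq_neg_of_add_eq_zero_right h0] at this
      simpa using this
    have hev := ((poly_sumSq hM (IsSumSq.one.add h1)).resolve_left hne).1
    have hPQ : P ≠ 0 ∧ Q ≠ 0 := by
      rw [hQ] at hne; exact mul_ne_zero_iff.1 hne
    have hdeg : (1 + S).natDegree = d + Q.natDegree := by
      rw [hQ, natDegree_mul hPQ.1 hPQ.2, hd]
    have hle : (1 + S).natDegree ≤ 2 * (d - 1) := by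
      refine natDegree_add_le_of_degree_le (by simp) (hd ▸ h2)
    rw [hdeg] at hev hle
    have hQodd : Odd Q.natDegree := by
      rw [Nat.even_add] at hev
      rw [← Nat.not_even_iff_odd] at hodd ⊢
      tauto
    refine ih Q.natDegree (by have := hodd.pos; omega) Q rfl hQodd ?_
    have : AdjoinRoot.mk Q (1 + S) = 0 := by rw [hQ, AdjoinRoot.mk_eq_zero]; exact dvd_mul_left _ _
    have h5 : AdjoinRoot.mk Q S = -1 := by
      rw [map_add, map_one] at this; linear_combination this
    rw [← h5]; exact sumSq_map _ h1

theorem maxSR_odd {M : Type u} [Field M] (hM : MaxSR M) (p : M[X]) (hp : Odd p.natDegree) : ∃ x, p.IsRoot x := by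
  induction p using WfDvdMonoid.induction_on_irreducible with
  | zero => simp at hp
  | unit u hu => rw [natDegree_eq_zero_of_isUnit hu] at hp; simp at hp
  | mul a i ha hi ih =>
    rw [natDegree_mul hi.ne_zero ha, Nat.odd_add] at hp
    by_cases h : Odd i.natDegree
    · haveI : Fact (Irreducible i) := ⟨hi⟩
      haveI : FiniteDimensional M (AdjoinRoot i) := (AdjoinRoot.powerBasis hi.ne_zero).finite
      obtain ⟨r, hr⟩ := hM.2 (AdjoinRoot i) (odd_sr hM.1 _ i rfl h) (AdjoinRoot.root i)
      refine ⟨r, ?_⟩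
      have h1 : aeval (AdjoinRoot.root i) i = 0 := by simp
      rw [← hr, aeval_algebraMap_apply] at h1
      have h2 := (algebraMap M (AdjoinRoot i)).injective (h1.trans (map_zero _).symm)
      simp only [coe_aeval_eq_eval] at h2
      simp [IsRoot, h2]
    · obtain ⟨x, hx⟩ := ih (by
        rw [← Nat.not_even_iff_odd]; tauto)
      refine ⟨x, ?_⟩
      rw [IsRoot] at hx
      simp [IsRoot, hx]

theorem maxSR_rc {M : Type u} [Field M] (hM : MaxSR M) : IsRealClosed M :=
  { toIsSemireal := IsSemireal.of_not_isSumSq_neg_one hM.1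
    isSquare_or_isSquare_neg := maxSR_or hM
    exists_isRoot_of_odd_natDegree := fun {f} hf => maxSR_odd hM f hf }

end SR

end Part7

section Part8

open Polynomial
open scoped QuadraticAlgebra

section SR2
universe u

theorem chain_sumSq {K Ω : Type*} [Field K] [Field Ω] [Algebra K Ω] (c : Set (IntermediateField K Ω))
    (hc : IsChain (· ≤ ·) c) (hne : c.Nonempty) (L : IntermediateField K Ω)
    (hL : ∀ x ∈ L, ∃ M ∈ c, x ∈ M) {a : L} (ha : IsSumSq a) :
    ∃ M ∈ c, ∃ b : M, IsSumSq b ∧ (b : Ω) = a := by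
  induction ha with
  | zero => obtain ⟨M, hM⟩ := hne; exact ⟨M, hM, 0, IsSumSq.zero, rfl⟩
  | sq_add x hs ih =>
    obtain ⟨M, hM, b, hb, hbs⟩ := ih
    obtain ⟨M', hM', hx⟩ := hL x.1 x.2
    rcases hc.total hM hM' with h | h
    · refine ⟨M', hM', ⟨x, hx⟩ * ⟨x, hx⟩ + IntermediateField.inclusion h b,
        IsSumSq.sq_add _ (sumSq_map (IntermediateField.inclusion h).toRingHom hb), ?_⟩
      simp [hbs]
    · refine ⟨M, hM, ⟨x, h hx⟩ * ⟨x, h hx⟩ + b, IsSumSq.sq_add _ hb, ?_⟩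
      simp [hbs]

theorem exists_maxSR (K : Type u) [Field K] (hK : ¬ IsSumSq (-1 : K)) :
    ∃ (M : Type u) (_ : Field M) (_ : Algebra K M), MaxSR M := by
  let Ω := AlgebraicClosure K
  obtain ⟨M, -, hM⟩ := zorn_le_nonempty₀ {M : IntermediateField K Ω | ¬ IsSumSq (-1 : M)} (by
    intro c hcs hc y hy
    haveI : Nonempty c := ⟨⟨y, hy⟩⟩
    have hdir : Directed (· ≤ ·) (fun M : c => (M : IntermediateField K Ω)) := by
      intro a b
      rcases hc.total a.2 b.2 with h | h
      · exact ⟨b, h, le_rfl⟩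
      · exact ⟨a, le_rfl, h⟩
    refine ⟨⨆ M : c, (M : IntermediateField K Ω), ?_, fun z hz => le_iSup (fun M : c => (M : IntermediateField K Ω)) ⟨z, hz⟩⟩
    intro h
    obtain ⟨M, hM, b, hb, hb1⟩ := chain_sumSq c hc ⟨y, hy⟩ _ (by
      intro x hx
      have hx' : x ∈ ((⨆ M : c, (M : IntermediateField K Ω) : IntermediateField K Ω) : Set Ω) := hx
      rw [IntermediateField.coe_iSup_of_directed hdir] at hx'
      obtain ⟨M, hM⟩ := Set.mem_iUnion.1 hx'
      exact ⟨M.1, M.2, hM⟩) h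
    apply hcs hM
    have : b = -1 := Subtype.ext (by simpa using hb1)
    rwa [← this]) ⊥ (by
      intro h
      apply hK
      have := sumSq_map (IntermediateField.botEquiv K Ω).toRingHom h
      simpa using this)
  refine ⟨M, inferInstance, inferInstance, hM.prop, ?_⟩
  intro N _ _ _ hN n
  let φ : N →ₐ[M] Ω := IsAlgClosed.lift
  let L : IntermediateField K Ω := φ.fieldRange.restrictScalars K
  have hML : M ≤ L := fun x hx => ⟨algebraMap M N ⟨x, hx⟩, φ.commutes ⟨x, hx⟩⟩
  have hL : ¬ IsSumSq (-1 : L) := by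
    intro h
    apply hN
    have := sumSq_map (AlgEquiv.ofInjectiveField φ).symm.toRingHom (x := (-1 : φ.fieldRange)) h
    have e : (AlgEquiv.ofInjectiveField φ).symm.toRingHom (-1 : φ.range) = -1 := by
      rw [map_neg, map_one]
    exact e ▸ this
  have hle := hM.le_of_ge hL hML
  have hn : φ n ∈ M := hle ⟨n, rfl⟩
  exact ⟨⟨φ n, hn⟩, φ.injective (φ.commutes ⟨φ n, hn⟩)⟩

theorem rc_sumSq {M : Type*} [Field M] [IsRealClosed M] {x : M} (hx : IsSumSq x) : IsSquare x := by
  rcases IsRealClosed.isSquare_or_isSquare_neg x with h | h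
  · exact h
  · have hM : ¬ IsSumSq (-1 : M) := by
      rw [← isSemireal_iff_not_isSumSq_neg_one]; infer_instance
    rw [sr_add hM hx h.isSumSq (by ring)]; exact IsSquare.zero

theorem rc_order (M : Type*) [Field M] [IsRealClosed M] : ∃ (_ : LinearOrder M), IsStrictOrderedRing M := by
  classical
  have hM : ¬ IsSumSq (-1 : M) := by
    rw [← isSemireal_iff_not_isSumSq_neg_one]; infer_instance
  let lo : LinearOrder M :=
    { le := fun x y => IsSquare (y - x)
      le_refl := fun x => by simp
      le_trans := fun x y z h1 h2 => by
        have : z - x = (y - x) + (z - y) := by ring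
        show IsSquare (z - x)
        rw [this]; exact rc_sumSq (h1.isSumSq.add h2.isSumSq)
      le_antisymm := fun x y h1 h2 => by
        have := sr_add hM h1.isSumSq h2.isSumSq (by ring)
        exact (sub_eq_zero.1 this).symm
      le_total := fun x y => by
        have := IsRealClosed.isSquare_or_isSquare_neg (y - x)
        rwa [neg_sub] at this
      toDecidableLE := Classical.decRel _ }
  refine ⟨lo, ?_⟩
  haveI : IsOrderedAddMonoid M := ⟨fun a b h c => by
    show IsSquare ((b + c) - (a + c)); rw [add_sub_add_right_eq_sub]; exact h, fun a b h c => by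
    show IsSquare ((c + b) - (c + a)); rw [add_sub_add_left_eq_sub]; exact h⟩
  haveI : ZeroLEOneClass M := ⟨by show IsSquare ((1 : M) - 0); simp⟩
  refine IsStrictOrderedRing.of_mul_pos fun a b ha hb => ?_
  refine lt_of_le_of_ne ?_ (mul_ne_zero ha.ne' hb.ne').symm
  have h1 : IsSquare (a - 0) := ha.le
  have h2 : IsSquare (b - 0) := hb.le
  show IsSquare (a * b - 0)
  rw [sub_zero] at *
  exact h1.mul h2
end SR2

end Part8

section Part9

section RN

def BadI {A : Type*} [CommRing A] (I : Ideal A) : Prop := ∃ s, IsSumSq s ∧ 1 + s ∈ I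

theorem sumSq_lift {A B : Type*} [CommRing A] [CommRing B] (φ : A →+* B) (hφ : Function.Surjective φ)
    {x : B} (h : IsSumSq x) : ∃ y, IsSumSq y ∧ φ y = x := by
  induction h with
  | zero => exact ⟨0, IsSumSq.zero, map_zero _⟩
  | sq_add a hs ih =>
    obtain ⟨y, hy, rfl⟩ := ih
    obtain ⟨b, rfl⟩ := hφ a
    exact ⟨b * b + y, IsSumSq.sq_add _ hy, by simp⟩

theorem sumSq_frac {B K : Type*} [CommRing B] [IsDomain B] [Field K] [Algebra B K] [IsFractionRing B K]
    {x : K} (h : IsSumSq x) : ∃ q P : B, q ≠ 0 ∧ IsSumSq P ∧ x * algebraMap B K (q * q) = algebraMap B K P := by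
  induction h with
  | zero => exact ⟨1, 0, one_ne_zero, IsSumSq.zero, by simp⟩
  | sq_add a hs ih =>
    obtain ⟨q, P, hq, hP, h⟩ := ih
    obtain ⟨c, d, hd, rfl⟩ := IsFractionRing.div_surjective (A := B) a
    have hd0 : d ≠ 0 := nonZeroDivisors.ne_zero hd
    have hd1 : algebraMap B K d ≠ 0 := by simpa using hd0
    refine ⟨d * q, (c * q) * (c * q) + (d * d) * P, mul_ne_zero hd0 hq,
      IsSumSq.sq_add _ ((IsSumSq.mul_self _).mul hP), ?_⟩
    simp only [map_mul, map_add] at h ⊢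
    rw [← h]
    field_simp

theorem bad_sup {A : Type*} [CommRing A] (I : Ideal A) (hI : Maximal (fun I : Ideal A => ¬ BadI I) I)
    {a : A} (ha : a ∉ I) : ∃ s c, IsSumSq s ∧ 1 + s - c * a ∈ I := by
  have : BadI (I ⊔ Ideal.span {a}) := by
    by_contra h
    have := hI.le_of_ge h le_sup_left
    exact ha (this (Ideal.mem_sup_right (Ideal.mem_span_singleton_self a)))
  obtain ⟨s, hs, h⟩ := this
  obtain ⟨i, hi, j, hj, hij⟩ := Submodule.mem_sup.1 h
  obtain ⟨c, rfl⟩ := Ideal.mem_span_singleton'.1 hj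
  exact ⟨s, c, hs, by rw [← hij]; simpa using hi⟩

theorem max_prime {A : Type*} [CommRing A] (I : Ideal A) (hI : Maximal (fun I : Ideal A => ¬ BadI I) I) :
    I.IsPrime := by
  refine ⟨?_, ?_⟩
  · rintro rfl
    exact hI.prop ⟨0, IsSumSq.zero, trivial⟩
  · intro a b hab
    by_contra hcon
    push Not at hcon
    obtain ⟨s, c, hs, h1⟩ := bad_sup I hI hcon.1
    obtain ⟨t, d, ht, h2⟩ := bad_sup I hI hcon.2
    refine hI.prop ⟨s + t + s * t, (hs.add ht).add (hs.mul ht), ?_⟩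
    have : 1 + (s + t + s * t) = (1 + t) * (1 + s - c * a) + (c * a) * (1 + t - d * b) + (c * d) * (a * b) := by ring
    rw [this]
    exact I.add_mem (I.add_mem (I.mul_mem_left _ h1) (I.mul_mem_left _ h2)) (I.mul_mem_left _ hab)

theorem max_semireal {A : Type*} [CommRing A] (I : Ideal A) (hI : Maximal (fun I : Ideal A => ¬ BadI I) I)
    [I.IsPrime] : ¬ IsSumSq (-1 : FractionRing (A ⧸ I)) := by
  intro h
  obtain ⟨q, P, hq, hP, h⟩ := sumSq_frac (B := A ⧸ I) h
  obtain ⟨P, hP', rfl⟩ := sumSq_lift (Ideal.Quotient.mk I) Ideal.Quotient.mk_surjective hP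
  obtain ⟨q, rfl⟩ := Ideal.Quotient.mk_surjective q
  have h0 : q * q + P ∈ I := by
    rw [← Ideal.Quotient.eq_zero_iff_mem]
    apply IsFractionRing.injective (A ⧸ I) (FractionRing (A ⧸ I))
    rw [map_add (Ideal.Quotient.mk I), map_add (algebraMap _ _), ← h, map_mul (Ideal.Quotient.mk I), map_zero]
    ring
  have hq' : q ∉ I := by rwa [ne_eq, Ideal.Quotient.eq_zero_iff_mem] at hq
  obtain ⟨s, c, hs, h1⟩ := bad_sup I hI hq'
  refine hI.prop ⟨s + s + s * s + c * c * P, ((hs.add hs).add (hs.mul hs)).add ((IsSumSq.mul_self _).mul hP'), ?_⟩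
  have : 1 + (s + s + s * s + c * c * P) = (1 + s + c * q) * (1 + s - c * q) + c * c * (q * q + P) := by ring
  rw [this]
  exact I.add_mem (I.mul_mem_left _ h1) (I.mul_mem_left _ h0)

theorem real_null {σ : Type} [Fintype σ] (J : Finset (MvPolynomial σ ℝ))
    (hJ : ¬ ∃ w : σ → ℝ, ∀ g ∈ J, MvPolynomial.eval w g = 0) :
    BadI (Ideal.span (J : Set (MvPolynomial σ ℝ))) := by
  classical
  by_contra hbad
  apply hJ
  obtain ⟨I, hJI, hI⟩ := zorn_le_nonempty₀ {I : Ideal (MvPolynomial σ ℝ) | ¬ BadI I} (by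
    intro c hcs hc y hy
    refine ⟨sSup c, ?_, fun z hz => le_sSup hz⟩
    rintro ⟨s, hs, h⟩
    obtain ⟨I, hI, h'⟩ := (Submodule.mem_sSup_of_directed ⟨y, hy⟩ hc.directedOn).1 h
    exact hcs hI ⟨s, hs, h'⟩) _ hbad
  haveI := max_prime I hI
  have hK := max_semireal I hI
  obtain ⟨M, _, _, hM⟩ := exists_maxSR _ hK
  haveI := maxSR_rc hM
  obtain ⟨_, _⟩ := rc_order M
  let φ : MvPolynomial σ ℝ →+* M :=
    ((algebraMap (FractionRing (MvPolynomial σ ℝ ⧸ I)) M).comp (algebraMap (MvPolynomial σ ℝ ⧸ I) _)).comp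
      (Ideal.Quotient.mk I)
  letI : Algebra ℝ M := (φ.comp MvPolynomial.C).toAlgebra
  have haev : ∀ g, MvPolynomial.aeval (fun j => φ (MvPolynomial.X j)) g = φ g := by
    intro g
    have := MvPolynomial.hom_eval₂ g MvPolynomial.C φ MvPolynomial.X
    rw [MvPolynomial.eval₂_eta] at this
    rw [this]; rfl
  refine descent (R := M) J (Finset.univ.image fun j => φ (MvPolynomial.X j)) (fun j => φ (MvPolynomial.X j)) ?_ ?_
  · intro j
    have : φ (MvPolynomial.X j) ∈ IntermediateField.adjoin ℝ ((Finset.univ.image fun j => φ (MvPolynomial.X j) : Finset M) : Set M) :=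
      IntermediateField.subset_adjoin _ _ (by simp)
    exact isAlgebraic_algebraMap (⟨_, this⟩ : IntermediateField.adjoin ℝ ((Finset.univ.image fun j => φ (MvPolynomial.X j) : Finset M) : Set M))
  · intro g hg
    rw [haev]
    have : Ideal.Quotient.mk I g = 0 := Ideal.Quotient.eq_zero_iff_mem.2 (hJI (Ideal.subset_span hg))
    simp [φ, this]
end RN

end Part9

section Part10

section Cert
open QuadraticAlgebra

variable {A D A' : Type*} [CommRing A] [CommRing D] [CommRing A'] (e : A →+* D) (w : D) (F : A)

def RepD (I : Ideal A) (z : D) : Prop := ∃ (N : ℕ) (P Q : A), P ∈ I ∧ Q ∈ I ∧ e (F ^ N) * z = e P + e Q * w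

theorem RepD.mul (hw : e F * (w * w) = -1) {I : Ideal A} {z z' : D} (h : RepD e w F ⊤ z) (h' : RepD e w F I z') : RepD e w F I (z * z') := by
  obtain ⟨N, P, Q, -, -, h⟩ := h
  obtain ⟨N', P', Q', hP', hQ', h'⟩ := h'
  refine ⟨N + N' + 1, F * (P * P') - Q * Q', F * (P * Q' + Q * P'), ?_, ?_, ?_⟩
  · exact I.sub_mem (I.mul_mem_left _ (I.mul_mem_left _ hP')) (I.mul_mem_left _ hQ')
  · exact I.mul_mem_left _ (I.add_mem (I.mul_mem_left _ hQ') (I.mul_mem_left _ hP'))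
  · simp only [map_pow, map_mul, map_add, map_sub] at *
    linear_combination (e F * e F ^ N' * z') * h + (e F * (e P + e Q * w)) * h' + e Q * e Q' * hw

theorem RepD.add {I : Ideal A} {z z' : D} (h : RepD e w F I z) (h' : RepD e w F I z') : RepD e w F I (z + z') := by
  obtain ⟨N, P, Q, hP, hQ, h⟩ := h
  obtain ⟨N', P', Q', hP', hQ', h'⟩ := h'
  refine ⟨N + N', F ^ N' * P + F ^ N * P', F ^ N' * Q + F ^ N * Q', ?_, ?_, ?_⟩
  · exact I.add_mem (I.mul_mem_left _ hP) (I.mul_mem_left _ hP')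
  · exact I.add_mem (I.mul_mem_left _ hQ) (I.mul_mem_left _ hQ')
  · simp only [map_pow, map_mul, map_add, map_sub] at *
    linear_combination (e F ^ N') * h + e F ^ N * h'

theorem RepD.coe {I : Ideal A} {a : A} (h : a ∈ I) : RepD e w F I (e a) :=
  ⟨0, a, 0, h, I.zero_mem, by simp⟩

theorem RepD.span (hw : e F * (w * w) = -1) (Φ : A' →+* D) {I : Ideal A} {J : Set A'} (hJ : ∀ g ∈ J, RepD e w F I (Φ g)) (hΦ : ∀ h, RepD e w F ⊤ (Φ h))
    {z : A'} (hz : z ∈ Ideal.span J) : RepD e w F I (Φ z) := by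
  induction hz using Submodule.span_induction with
  | mem g hg => exact hJ g hg
  | zero => rw [map_zero, ← map_zero e]; exact RepD.coe e w F I.zero_mem
  | add x y _ _ hx hy => rw [map_add]; exact RepD.add e w F hx hy
  | smul a x _ hx => rw [smul_eq_mul, map_mul]; exact RepD.mul e w F hw (hΦ a) hx

theorem RepD.sumSq (hw : e F * (w * w) = -1) (Φ : A' →+* D) (hΦ : ∀ h, RepD e w F ⊤ (Φ h)) {s : A'} (hs : IsSumSq s) :
    ∃ (N : ℕ) (S T Q : A), IsSumSq S ∧ IsSumSq T ∧ e (F ^ (2 * N + 1)) * Φ s = e (F * S - T) + e Q * w := by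
  induction hs with
  | zero => exact ⟨0, 0, 0, 0, IsSumSq.zero, IsSumSq.zero, by simp⟩
  | sq_add f hs ih =>
    obtain ⟨N, S, T, Q, hS, hT, h⟩ := ih
    obtain ⟨N', P', Q', -, -, h'⟩ := hΦ f
    refine ⟨N + N', (F ^ N * P') * (F ^ N * P') + (F ^ N' * F ^ N') * S,
      (F ^ N * Q') * (F ^ N * Q') + (F ^ N' * F ^ N') * T, F ^ (2 * N + 1) * (2 * P' * Q') + F ^ (2 * N') * Q,
      IsSumSq.sq_add _ ((IsSumSq.mul_self _).mul hS), IsSumSq.sq_add _ ((IsSumSq.mul_self _).mul hT), ?_⟩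
    have h2 : e (F ^ (2 * N' + 1)) * (Φ f * Φ f) = e (F * (P' * P') - Q' * Q') + e (F * (2 * P' * Q')) * w := by
      have h2 : e (2 : A) = 2 := map_ofNat e 2
      simp only [map_pow, map_mul, map_add, map_sub, h2] at *
      linear_combination (e F * (e F ^ N' * Φ f + (e P' + e Q' * w))) * h' + e Q' * e Q' * hw
    have h3 : e (2 : A) = 2 := map_ofNat e 2
    simp only [map_pow, map_mul, map_add, map_sub, h3] at *
    linear_combination (e F ^ (2 * N)) * h2 + e F ^ (2 * N') * h
end Cert

section Fin
open scoped QuadraticAlgebra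
open MvPolynomial

theorem quadA_w {K : Type*} [Field K] (f : K) (hf : f ≠ 0) :
    (⟨f, 0⟩ : QuadraticAlgebra K (-f⁻¹) 0) * (⟨0, 1⟩ * ⟨0, 1⟩) = -1 := by
  ext <;> simp [hf]

theorem quadA_re {K : Type*} [Field K] (c x : K) :
    ((⟨x, 0⟩ : QuadraticAlgebra K c 0) * ⟨0, 1⟩).re = 0 := by
  simp

theorem cert_exists {n : ℕ} (F : MvPolynomial (Fin n) ℝ) (hF : F ≠ 0) (G : Finset (MvPolynomial (Fin n) ℝ))
    (h : ∀ x : Fin n → ℝ, (∀ g ∈ G, eval x g = 0) → 0 ≤ eval x F) :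
    ∃ (a : ℕ) (s₁ s₂ U : MvPolynomial (Fin n) ℝ), IsSumSq s₁ ∧ IsSumSq s₂ ∧ U ∈ Ideal.span (G : Set (MvPolynomial (Fin n) ℝ)) ∧
      s₁ * F - (s₂ + U) - F ^ (2 * a) = 0 := by
  classical
  let A := MvPolynomial (Fin n) ℝ
  let K := FractionRing A
  let c : K := -(algebraMap A K F)⁻¹
  let D := QuadraticAlgebra K c 0
  let e : A →+* D := (algebraMap K D).comp (algebraMap A K)
  let w : D := ⟨0, 1⟩
  have hF0 : algebraMap A K F ≠ 0 := by simpa using hF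
  have hee : ∀ a, e a = ⟨algebraMap A K a, 0⟩ := fun a => rfl
  have hw : e F * (w * w) = -1 := by
    rw [hee]
    exact quadA_w _ hF0
  let Φ : MvPolynomial (Option (Fin n)) ℝ →+* D :=
    eval₂Hom (e.comp C) (fun o => o.elim w (fun i => e (X i)))
  have hΦr : ∀ a : A, Φ (rename some a) = e a := by
    intro a
    have := hom_eval₂ a C e X
    rw [eval₂_eta] at this
    rw [this]
    simp only [Φ, coe_eval₂Hom, eval₂_rename]
    rfl
  have hΦX : Φ (X none) = w := by simp [Φ]
  have hΦ : ∀ p, RepD e w F ⊤ (Φ p) := by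
    intro p
    induction p using MvPolynomial.induction_on with
    | C r =>
      have : Φ (C r) = e (C r) := by simp [Φ]
      rw [this]; exact RepD.coe e w F trivial
    | add p q hp hq => rw [map_add]; exact RepD.add e w F hp hq
    | mul_X p i hp =>
      rw [map_mul]
      refine RepD.mul e w F hw hp ?_
      cases i with
      | none => rw [hΦX]; exact ⟨0, 0, 1, trivial, trivial, by simp⟩
      | some i =>
        have : Φ (X (some i)) = e (X i) := by simp [Φ]
        rw [this]; exact RepD.coe e w F trivial
  obtain ⟨s, hs, h1⟩ := real_null (σ := Option (Fin n))
    (insert (X none ^ 2 * rename some F + 1) (G.image (rename some))) (by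
      rintro ⟨x, hx⟩
      have e1 := hx _ (Finset.mem_insert_self _ _)
      have e2 := h (x ∘ some) (fun g hg => by
        have := hx _ (Finset.mem_insert_of_mem (Finset.mem_image_of_mem _ hg))
        rwa [eval_rename] at this)
      simp only [map_add, map_mul, map_pow, eval_X, map_one, eval_rename] at e1
      nlinarith [mul_nonneg (sq_nonneg (x none)) e2])
  obtain ⟨N, S, T, Q, hS, hT, h2⟩ := RepD.sumSq e w F hw Φ hΦ hs
  obtain ⟨M, U, V, hU, -, h3⟩ := RepD.span e w F hw Φ (I := Ideal.span (G : Set A)) (by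
    intro g hg
    rw [Finset.mem_coe, Finset.mem_insert] at hg
    rcases hg with rfl | hg
    · have : Φ (X none ^ 2 * rename some F + 1) = e 0 := by
        rw [map_add, map_mul, map_pow, hΦX, hΦr, map_one, map_zero]; linear_combination hw
      rw [this]; exact RepD.coe e w F (Ideal.zero_mem _)
    · obtain ⟨g, hg', rfl⟩ := Finset.mem_image.1 hg
      rw [hΦr]; exact RepD.coe e w F (Ideal.subset_span hg')) hΦ h1
  have h4 : e (F ^ (2 * N + 2 * M + 2) + F ^ (2 * M + 2) * S - F ^ (2 * M + 1) * T - F ^ (2 * N + M + 2) * U) =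
      e (F ^ (2 * N + M + 2) * V - F ^ (2 * M + 1) * Q) * w := by
    rw [map_add, map_one] at h3
    simp only [map_pow, map_mul, map_add, map_sub] at *
    linear_combination (-e F ^ (2 * M + 1)) * h2 + e F ^ (2 * N + M + 2) * h3
  have h5 : F ^ (2 * N + 2 * M + 2) + F ^ (2 * M + 2) * S - F ^ (2 * M + 1) * T - F ^ (2 * N + M + 2) * U = 0 := by
    apply IsFractionRing.injective A K
    have := congrArg QuadraticAlgebra.re h4
    rw [hee, hee] at this
    rw [map_zero]
    exact this.trans (quadA_re _ _)
  refine ⟨N + M + 1, F ^ M * F ^ M * T, F ^ (M + 1) * F ^ (M + 1) * S, -F ^ (2 * N + M + 2) * U,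
    (IsSumSq.mul_self _).mul hT, (IsSumSq.mul_self _).mul hS, Ideal.mul_mem_left _ _ hU, ?_⟩
  linear_combination -h5
end Fin

end Part10

theorem isSOS_of_sumSq {n : ℕ} {s : MvPolynomial (Fin n) ℝ} (h : IsSumSq s) : IsSOS s := by
  induction h with
  | zero => exact ⟨0, fun _ => 0, by simp⟩
  | sq_add a hs ih =>
    obtain ⟨k, p, rfl⟩ := ih
    exact ⟨k + 1, Fin.cons a p, by simp [Fin.sum_univ_succ, sq]⟩

theorem isSOS_eval {n : ℕ} {s : MvPolynomial (Fin n) ℝ} (h : IsSOS s) (x : Fin n → ℝ) :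
    0 ≤ MvPolynomial.eval x s := by
  obtain ⟨k, p, rfl⟩ := h
  simp only [map_sum, map_pow]
  exact Finset.sum_nonneg fun i _ => sq_nonneg _

/-- `L_f b ≥ 0` on `K = {x : b(x) = 0, (L_g b)_j(x) = 0 ∀ j}` iff there is a
Positivstellensatz certificate `h₁ (L_f b) - h₂ - (L_f b)^{2a} = 0` with
`hᵢ = sᵢ + b pᵢ₀ + ∑ⱼ (L_g b)ⱼ pᵢⱼ`, `sᵢ` SOS. -/
theorem single_cbf_verification_iff {n m : ℕ} (b : MvPolynomial (Fin n) ℝ)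
    (f : Fin n → MvPolynomial (Fin n) ℝ)
    (g : Fin n → Fin m → MvPolynomial (Fin n) ℝ) :
    (∀ x : Fin n → ℝ,
        (MvPolynomial.eval x b = 0 ∧ ∀ j : Fin m, MvPolynomial.eval x (LieG g b j) = 0) →
        0 ≤ MvPolynomial.eval x (LieF f b)) ↔
      ∃ (a : ℕ) (s₁ s₂ p₁₀ p₂₀ : MvPolynomial (Fin n) ℝ)
        (p₁ p₂ : Fin m → MvPolynomial (Fin n) ℝ),
        IsSOS s₁ ∧ IsSOS s₂ ∧
        (s₁ + b * p₁₀ + ∑ j, LieG g b j * p₁ j) * LieF f b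
          - (s₂ + b * p₂₀ + ∑ j, LieG g b j * p₂ j)
          - (LieF f b) ^ (2 * a) = 0 := by
  constructor
  · intro h
    by_cases hF : LieF f b = 0
    · exact ⟨1, 0, 0, 0, 0, 0, 0, isSOS_of_sumSq IsSumSq.zero, isSOS_of_sumSq IsSumSq.zero, by simp [hF]⟩
    · classical
      obtain ⟨a, s₁, s₂, U, h1, h2, hU, he⟩ := cert_exists (LieF f b) hF
        (insert b (Finset.univ.image (LieG g b))) (fun x hx => h x
          ⟨hx b (Finset.mem_insert_self _ _), fun j => hx _ (Finset.mem_insert_of_mem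
            (Finset.mem_image_of_mem _ (Finset.mem_univ j)))⟩)
      rw [Finset.coe_insert, Finset.coe_image, Finset.coe_univ, Set.image_univ,
        Ideal.mem_span_insert] at hU
      obtain ⟨p, z, hz, rfl⟩ := hU
      obtain ⟨c, rfl⟩ := Ideal.mem_span_range_iff_exists_fun.1 hz
      refine ⟨a, s₁, s₂, 0, p, 0, c, isSOS_of_sumSq h1, isSOS_of_sumSq h2, ?_⟩
      have hc : ∑ j, LieG g b j * c j = ∑ j, c j * LieG g b j :=
        Finset.sum_congr rfl fun j _ => mul_comm _ _
      have h0 : ∑ j, LieG g b j * (0 : Fin m → MvPolynomial (Fin n) ℝ) j = 0 := by simp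
      rw [hc, h0]
      linear_combination he
  · rintro ⟨a, s₁, s₂, p₁₀, p₂₀, p₁, p₂, h1, h2, he⟩ x ⟨hb, hg⟩
    by_contra hneg
    push Not at hneg
    have hx := congrArg (MvPolynomial.eval x) he
    simp only [map_sub, map_mul, map_add, map_sum, map_pow, map_zero, hb, hg, zero_mul,
      Finset.sum_const_zero, add_zero] at hx
    have e1 := isSOS_eval h1 x
    have e2 := isSOS_eval h2 x
    have e3 : 0 < MvPolynomial.eval x (LieF f b) ^ (2 * a) := by
      rw [pow_mul]; exact pow_pos (sq_pos_of_neg hneg) _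
    have e4 := mul_nonpos_of_nonneg_of_nonpos e1 hneg.le
    linarith
end

section
/- Let b ∈ ℝ[x₁,…,xₙ] be a polynomial, let f = (f₁,…,fₙ) be a vector of polynomials and g = (g_{ij}) an n×m matrix of polynomials in ℝ[x₁,…,xₙ], and let K = {x ∈ ℝⁿ : b(x) = 0 and (L_g b)_j(x) = 0 for all j = 1,…,m}. Suppose there exist a natural number a ≥ 0, SOS polynomials s₁, s₂, and polynomials p₁₀, p₂₀, p₁ⱼ, p₂ⱼ ∈ ℝ[x₁,…,xₙ] (j = 1,…,m) such that, with hᵢ = sᵢ + b·pᵢ₀ + Σ_{j=1}^m (L_g b)_j·pᵢⱼ for i = 1,2, the polynomial identity h₁·(L_f b) − h₂ − (L_f b)^{2a} = 0 holds. Then L_f b(x) ≥ 0 for every x ∈ K. -/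
/-- If an SOS Positivstellensatz certificate exists, then `L_f b ≥ 0` on
`K = {x : b(x) = 0, (L_g b)_j(x) = 0 ∀ j}`. -/
theorem single_cbf_certificate_implies_nonneg {n m : ℕ} (b : MvPolynomial (Fin n) ℝ)
    (f : Fin n → MvPolynomial (Fin n) ℝ)
    (g : Fin n → Fin m → MvPolynomial (Fin n) ℝ)
    (a : ℕ) (s₁ s₂ p₁₀ p₂₀ : MvPolynomial (Fin n) ℝ)
    (p₁ p₂ : Fin m → MvPolynomial (Fin n) ℝ)
    (hs₁ : IsSOS s₁) (hs₂ : IsSOS s₂)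
    (hcert : (s₁ + b * p₁₀ + ∑ j, LieG g b j * p₁ j) * LieF f b
        - (s₂ + b * p₂₀ + ∑ j, LieG g b j * p₂ j)
        - (LieF f b) ^ (2 * a) = 0) :
    ∀ x : Fin n → ℝ,
      (MvPolynomial.eval x b = 0 ∧ ∀ j : Fin m, MvPolynomial.eval x (LieG g b j) = 0) →
      0 ≤ MvPolynomial.eval x (LieF f b) := by
  rintro x ⟨hb, hg⟩
  have hnn : ∀ s : MvPolynomial (Fin n) ℝ, IsSOS s → 0 ≤ MvPolynomial.eval x s := by
    rintro s ⟨k, p, rfl⟩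
    rw [map_sum]
    refine Finset.sum_nonneg fun i _ => ?_
    rw [map_pow]
    exact sq_nonneg _
  have h1 := hnn s₁ hs₁
  have h2 := hnn s₂ hs₂
  have h := congrArg (MvPolynomial.eval x) hcert
  simp only [map_sub, map_add, map_mul, map_sum, map_pow, map_zero, hb, hg, zero_mul,
    Finset.sum_const_zero, add_zero] at h
  by_contra hlt
  have hlt' := not_le.mp hlt
  have hpos : 0 < (MvPolynomial.eval x (LieF f b)) ^ (2 * a) := by
    rw [pow_mul]
    exact pow_pos (sq_pos_of_neg hlt') a
  have := mul_nonpos_of_nonneg_of_nonpos h1 hlt'.le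
  linarith
end
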